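/- (Young's superposition principle) For the compact interval I and d ≥ 1, the set 𝒯(I,ℝᵈ) of transport measures is the closed convex envelope, in the Young measure space 𝒴₁(I,ℝ^{2d}), of the set 𝒞(I,ℝᵈ) of measures γ̄ associated to absolutely continuous curves γ: I → ℝᵈ. -/

import Mathlib

open MeasureTheory Filter Topology Set ENNReal

noncomputable section

/-!
Following the paper, the complete Riemannian manifold `M` without boundary is modelled
(via an isometric embedding into Euclidean space) on a finite-dimensional real inner
product space `E`, itself a complete Riemannian manifold without boundary; its tangent
bundle is `TM = E × E` with `‖v‖ₓ = ‖v‖`.  A point of `I × TM` is `p = (t, x, v)`.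
The Kantorovich–Rubinstein topology of `𝒴₁(I, TM)` is expressed through (sequential)
convergence of integrals of continuous functions with at most linear growth in `v`,
using the paper's normalisation that `(1 + d((x₀,0),(x,v)))/(1 + ‖v‖ₓ)` is bounded
above and below.
-/

variable {E : Type*} [NormedAddCommGroup E] [InnerProductSpace ℝ E]
  [FiniteDimensional ℝ E] [MeasurableSpace E] [BorelSpace E]

/-- Normalized Lebesgue measure on the interval `[a,b]`. -/
def lam (a b : ℝ) : Measure ℝ := (ENNReal.ofReal (b - a))⁻¹ • (volume.restrict (Icc a b))

/-- Young measures with finite first moment: probability measures on `I × TM`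
whose marginal on `I` is the normalized Lebesgue measure `lam a b`. -/
def IsYoung1 (a b : ℝ) (η : Measure (ℝ × E × E)) : Prop :=
  IsProbabilityMeasure η ∧ η.map Prod.fst = lam a b ∧
    Integrable (fun p : ℝ × E × E => ‖p.2.2‖) η

/-- Convergence in the Kantorovich–Rubinstein space `𝒴₁(I,TM)`: integrals of all
continuous functions with at most linear growth converge. -/
def Y1Tendsto (ηs : ℕ → Measure (ℝ × E × E)) (η : Measure (ℝ × E × E)) : Prop :=
  ∀ f : ℝ × E × E → ℝ, Continuous f → (∃ C : ℝ, ∀ p, |f p| ≤ C * (1 + ‖p.2.2‖)) →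
    Tendsto (fun n => ∫ p, f p ∂(ηs n)) atTop (𝓝 (∫ p, f p ∂η))

/-- Smooth test function compactly supported in `]a,b[ × M`. -/
def IsTestInterior (a b : ℝ) (g : ℝ → E → ℝ) : Prop :=
  ContDiff ℝ (⊤ : ℕ∞) (Function.uncurry g) ∧ HasCompactSupport (Function.uncurry g) ∧
    tsupport (Function.uncurry g) ⊆ Ioo a b ×ˢ (univ : Set E)

/-- Smooth test function compactly supported in `[a,b] × M`. -/
def IsTestClosed (g : ℝ → E → ℝ) : Prop :=
  ContDiff ℝ (⊤ : ℕ∞) (Function.uncurry g) ∧ HasCompactSupport (Function.uncurry g)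

/-- The integrand `∂ₜ g + ∂ₓ g · v` at the point `p = (t, x, v)`. -/
def tIntegrand (g : ℝ → E → ℝ) (p : ℝ × E × E) : ℝ :=
  deriv (fun s => g s p.2.1) p.1 + fderiv ℝ (fun y => g p.1 y) p.2.1 p.2.2

/-- Transport measures on `I = [a,b]`. -/
def IsTransport (a b : ℝ) (η : Measure (ℝ × E × E)) : Prop :=
  IsYoung1 a b η ∧ ∀ g : ℝ → E → ℝ, IsTestInterior a b g → ∫ p, tIntegrand g p ∂η = 0

/-- Transport measures between `μi` and `μf`. -/
def IsTransportBetween (a b : ℝ) (η : Measure (ℝ × E × E)) (μi μf : Measure E) : Prop :=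
  IsYoung1 a b η ∧ ∀ g : ℝ → E → ℝ, IsTestClosed g →
    ∫ p, tIntegrand g p ∂η = (∫ x, g b x ∂μf) - ∫ x, g a x ∂μi

/-- `η` is a generalized curve above the continuous curve `γ`: it is a transport
measure whose time-`t` marginals on `M` are the Dirac measures `δ_{γ(t)}`,
i.e. its `(t,x)`-marginal is `dt ⊗ δ_{γ(t)}`. -/
def IsGenCurve (a b : ℝ) (η : Measure (ℝ × E × E)) (γ : ℝ → E) : Prop :=
  IsTransport a b η ∧ ContinuousOn γ (Icc a b) ∧
    η.map (fun p => (p.1, p.2.1)) = (lam a b).map (fun t => (t, γ t))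

/-- `γ` is absolutely continuous on `[a,b]` with derivative `γ'`. -/
def IsACCurve (a b : ℝ) (γ γ' : ℝ → E) : Prop :=
  IntervalIntegrable γ' volume a b ∧ ∀ t ∈ Icc a b, γ t = γ a + ∫ s in a..t, γ' s

/-- The measure `γ̄ = dt ⊗ δ_{γ(t)} ⊗ δ_{γ̇(t)}` associated with a curve. -/
def curveMeasure (a b : ℝ) (γ γ' : ℝ → E) : Measure (ℝ × E × E) :=
  (lam a b).map (fun t => (t, γ t, γ' t))

/-- The nonnegative part of an extended real, as an `ℝ≥0∞`. -/
def epos (x : EReal) : ℝ≥0∞ := if x = ⊤ then ⊤ else ENNReal.ofReal x.toReal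

/-- The integral of an `EReal`-valued function: positive part minus negative part. -/
def eInt {α : Type*} [MeasurableSpace α] (μ : Measure α) (f : α → EReal) : EReal :=
  ((∫⁻ x, epos (f x) ∂μ : ℝ≥0∞) : EReal) - ((∫⁻ x, epos (-f x) ∂μ : ℝ≥0∞) : EReal)

/-- Normal integrand: Borel measurable and lower semicontinuous in `(x,v)`. -/
def IsNormalIntegrand (L : ℝ × E × E → EReal) : Prop :=
  Measurable L ∧ ∀ t : ℝ, LowerSemicontinuous (fun q : E × E => L (t, q.1, q.2))

/-- Fiberwise convexity: `v ↦ L (t, x, v)` is convex for each fixed `(t,x)`. -/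
def FiberwiseConvex (L : ℝ × E × E → EReal) : Prop :=
  ∀ (t : ℝ) (x v w : E) (θ₁ θ₂ : ℝ), 0 ≤ θ₁ → 0 ≤ θ₂ → θ₁ + θ₂ = 1 →
    L (t, x, θ₁ • v + θ₂ • w) ≤ (θ₁ : EReal) * L (t, x, v) + (θ₂ : EReal) * L (t, x, w)

lemma lam_integral {a b : ℝ} (hab : a < b) (f : ℝ → ℝ) :
    ∫ t, f t ∂(lam a b) = (b - a)⁻¹ * ∫ t in a..b, f t := by
  have h : 0 < b - a := by linarith
  rw [lam, integral_smul_measure, intervalIntegral.integral_of_le hab.le,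
    integral_Icc_eq_integral_Ioc, ENNReal.toReal_inv, ENNReal.toReal_ofReal h.le, smul_eq_mul]

lemma lam_prob {a b : ℝ} (hab : a < b) : IsProbabilityMeasure (lam a b) := by
  constructor
  have h : 0 < b - a := by linarith
  simp only [lam, Measure.smul_apply, Measure.restrict_apply_univ, Real.volume_Icc, smul_eq_mul]
  exact ENNReal.inv_mul_cancel (by simpa using h) ENNReal.ofReal_ne_top

lemma lam_integrable {a b : ℝ} (hab : a < b) {F : Type*} [NormedAddCommGroup F] {f : ℝ → F}
    (hf : IntervalIntegrable f volume a b) : Integrable f (lam a b) := by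
  have h : 0 < b - a := by linarith
  unfold lam
  apply Integrable.smul_measure
  · rw [intervalIntegrable_iff_integrableOn_Icc_of_le hab.le] at hf
    exact hf
  · simpa using h

lemma ACCurve_continuousOn {a b : ℝ} (hab : a < b) {γ γ' : ℝ → E} (h : IsACCurve a b γ γ') :
    ContinuousOn γ (Icc a b) := by
  have h1 : ContinuousOn (fun t => γ a + ∫ s in a..t, γ' s) (Icc a b) := by
    apply continuousOn_const.add
    have := intervalIntegral.continuousOn_primitive_interval' (h.1) (a := a) (by simp)
    rwa [uIcc_of_le hab.le] at this
  exact h1.congr h.2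

lemma curve_aemeas {a b : ℝ} (hab : a < b) {γ γ' : ℝ → E} (h : IsACCurve a b γ γ') :
    AEMeasurable (fun t => (t, γ t, γ' t)) (lam a b) := by
  have h1 : AEMeasurable γ (lam a b) := by
    unfold lam
    exact ((ACCurve_continuousOn hab h).aemeasurable measurableSet_Icc).smul_measure _
  have h2 : AEMeasurable γ' (lam a b) := (lam_integrable hab h.1).aemeasurable
  exact aemeasurable_id.prodMk (h1.prodMk h2)

lemma curve_prob {a b : ℝ} (hab : a < b) {γ γ' : ℝ → E} (h : IsACCurve a b γ γ') :
    IsProbabilityMeasure (curveMeasure a b γ γ') := by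
  have := lam_prob hab
  exact Measure.isProbabilityMeasure_map (curve_aemeas hab h)

lemma curve_integral {a b : ℝ} (hab : a < b) {γ γ' : ℝ → E} (h : IsACCurve a b γ γ')
    {F : ℝ × E × E → ℝ} (hF : Continuous F) :
    ∫ p, F p ∂(curveMeasure a b γ γ') = (b - a)⁻¹ * ∫ t in a..b, F (t, γ t, γ' t) := by
  rw [curveMeasure, integral_map (curve_aemeas hab h) hF.aestronglyMeasurable, lam_integral hab]

lemma curve_integrable {a b : ℝ} (hab : a < b) {γ γ' : ℝ → E} (h : IsACCurve a b γ γ')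
    {F : ℝ × E × E → ℝ} (hF : Continuous F) {C : ℝ} (hC : ∀ p, |F p| ≤ C * (1 + ‖p.2.2‖)) :
    Integrable F (curveMeasure a b γ γ') := by
  have := lam_prob hab
  rw [curveMeasure, integrable_map_measure hF.aestronglyMeasurable (curve_aemeas hab h)]
  refine Integrable.mono' (g := fun t => C * (1 + ‖γ' t‖)) ?_ ?_ ?_
  · exact ((integrable_const _).add (lam_integrable hab h.1).norm).const_mul _
  · exact (hF.measurable.comp_aemeasurable (curve_aemeas hab h)).aestronglyMeasurable
  · exact Eventually.of_forall fun t => hC _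

lemma young_integrable {a b : ℝ} {η : Measure (ℝ × E × E)} (h : IsYoung1 a b η)
    {F : ℝ × E × E → ℝ} (hF : Continuous F) {C : ℝ} (hC : ∀ p, |F p| ≤ C * (1 + ‖p.2.2‖)) :
    Integrable F η := by
  have := h.1
  refine Integrable.mono' (g := fun p => C * (1 + ‖p.2.2‖)) ?_ hF.aestronglyMeasurable
    (Eventually.of_forall hC)
  exact ((integrable_const _).add h.2.2).const_mul _

lemma tIntegrand_eq {g : ℝ → E → ℝ} {p : ℝ × E × E}
    (h : DifferentiableAt ℝ (Function.uncurry g) (p.1, p.2.1)) :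
    tIntegrand g p = fderiv ℝ (Function.uncurry g) (p.1, p.2.1) (1, p.2.2) := by
  have h1 : HasDerivAt (fun s => g s p.2.1)
      (fderiv ℝ (Function.uncurry g) (p.1, p.2.1) (1, 0)) p.1 := by
    have : HasDerivAt (fun s : ℝ => (s, p.2.1)) ((1 : ℝ), (0 : E)) p.1 :=
      (hasDerivAt_id _).prodMk (hasDerivAt_const _ _)
    exact h.hasFDerivAt.comp_hasDerivAt p.1 this
  have h2 : HasFDerivAt (fun y => g p.1 y)
      ((fderiv ℝ (Function.uncurry g) (p.1, p.2.1)).comp (ContinuousLinearMap.inr ℝ ℝ E)) p.2.1 :=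
    HasFDerivAt.comp p.2.1 (g := Function.uncurry g) (f := fun y => (p.1, y))
      h.hasFDerivAt (hasFDerivAt_prodMk_right p.1 p.2.1)
  unfold tIntegrand
  rw [h1.deriv, h2.fderiv]
  simp only [ContinuousLinearMap.comp_apply, ContinuousLinearMap.inr_apply]
  rw [← map_add]
  simp

lemma tIntegrand_cont {g : ℝ → E → ℝ} (h : ContDiff ℝ (⊤ : ℕ∞) (Function.uncurry g)) :
    Continuous (tIntegrand g) := by
  have : tIntegrand g =
      fun p : ℝ × E × E => fderiv ℝ (Function.uncurry g) (p.1, p.2.1) (1, p.2.2) := by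
    ext p
    exact tIntegrand_eq (h.differentiable (by simp) _)
  rw [this]
  have h1 := h.continuous_fderiv (by simp)
  exact (h1.comp (by fun_prop)).clm_apply (by fun_prop)

lemma tIntegrand_bound {g : ℝ → E → ℝ} (h : ContDiff ℝ (⊤ : ℕ∞) (Function.uncurry g))
    (hc : HasCompactSupport (Function.uncurry g)) :
    ∃ C : ℝ, ∀ p, |tIntegrand g p| ≤ C * (1 + ‖p.2.2‖) := by
  obtain ⟨K, hK⟩ := h.lipschitzWith_of_hasCompactSupport hc (by simp)
  obtain ⟨C, hC0, hC⟩ : ∃ C : ℝ, 0 ≤ C ∧ ∀ x, ‖fderiv ℝ (Function.uncurry g) x‖ ≤ C :=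
    ⟨K, K.coe_nonneg, fun x => norm_fderiv_le_of_lipschitz ℝ hK⟩
  refine ⟨C, fun p => ?_⟩
  rw [tIntegrand_eq (h.differentiable (by simp) _), ← Real.norm_eq_abs]
  refine (ContinuousLinearMap.le_opNorm _ _).trans ?_
  refine mul_le_mul (hC _) ?_ (norm_nonneg _) hC0
  rw [Prod.norm_def]
  simp only [norm_one]
  exact max_le (by linarith [norm_nonneg p.2.2]) (by linarith)

lemma ac_of_dom {f : ℝ → ℝ} {Φ : ℝ → ℝ} {a b : ℝ} (hΦ : AbsolutelyContinuousOnInterval Φ a b)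
    (h : ∀ s ∈ uIcc a b, ∀ t ∈ uIcc a b, dist (f s) (f t) ≤ dist (Φ s) (Φ t)) :
    AbsolutelyContinuousOnInterval f a b := by
  unfold AbsolutelyContinuousOnInterval at *
  refine squeeze_zero' (Eventually.of_forall fun _ => Finset.sum_nonneg fun _ _ => dist_nonneg)
    ?_ hΦ
  filter_upwards [mem_inf_of_right (mem_principal_self _)] with I hI
  refine Finset.sum_le_sum fun i hi => ?_
  have := hI.1 i hi
  exact h _ this.1 _ this.2

lemma curve_transport {a b : ℝ} (hab : a < b) {γ γ' : ℝ → E} (h : IsACCurve a b γ γ')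
    {g : ℝ → E → ℝ} (hg : IsTestInterior a b g) :
    ∫ p, tIntegrand g p ∂(curveMeasure a b γ γ') = 0 := by
  obtain ⟨hg1, hg2, hg3⟩ := hg
  rw [curve_integral hab h (tIntegrand_cont hg1)]
  set G := Function.uncurry g with hG
  let β : ℝ → E := fun t => γ a + ∫ s in a..t, γ' s
  obtain ⟨K, hK⟩ := hg1.lipschitzWith_of_hasCompactSupport hg2 (by simp)
  have hI : ∀ s ∈ Icc a b, ∀ t ∈ Icc a b, IntervalIntegrable γ' volume s t := by
    intro s hs t ht
    exact h.1.mono_set (by rw [uIcc_of_le hab.le]; exact uIcc_subset_Icc hs ht)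
  have hac : AbsolutelyContinuousOnInterval (fun t => G (t, β t)) a b := by
    have h1 : AbsolutelyContinuousOnInterval (fun t => ∫ s in a..t, (1 + ‖γ' s‖)) a b := by
      apply IntervalIntegrable.absolutelyContinuousOnInterval_intervalIntegral _ (by simp)
      exact (intervalIntegrable_const).add h.1.norm
    refine ac_of_dom (h1.const_mul K) ?_
    rw [uIcc_of_le hab.le]
    have key : ∀ s ∈ Icc a b, ∀ t ∈ Icc a b, s ≤ t →
        dist (G (s, β s)) (G (t, β t)) ≤ dist (K * ∫ r in a..s, (1 + ‖γ' r‖))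
          (K * ∫ r in a..t, (1 + ‖γ' r‖)) := by
      intro s hs t ht hst
      have ha : a ∈ Icc a b := ⟨le_rfl, hab.le⟩
      have e1 : ∀ s ∈ Icc a b, ∀ t ∈ Icc a b,
          IntervalIntegrable (fun r => 1 + ‖γ' r‖) volume s t := fun s hs t ht =>
        (intervalIntegrable_const).add (hI s hs t ht).norm
      rw [dist_comm ((K : ℝ) * _), Real.dist_eq ((K : ℝ) * _), ← mul_sub,
        intervalIntegral.integral_interval_sub_left (e1 _ ha _ ht) (e1 _ ha _ hs), abs_mul,
        abs_of_nonneg K.coe_nonneg]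
      refine (hK.dist_le_mul _ _).trans ?_
      refine mul_le_mul_of_nonneg_left ?_ K.coe_nonneg
      rw [intervalIntegral.integral_add intervalIntegrable_const (hI _ hs _ ht).norm]
      have n1 : ‖∫ r in s..t, γ' r‖ ≤ ∫ r in s..t, ‖γ' r‖ :=
        intervalIntegral.norm_integral_le_integral_norm hst
      have n0 := (norm_nonneg _).trans n1
      refine le_trans ?_ (le_abs_self _)
      rw [Prod.dist_eq]
      simp only [intervalIntegral.integral_const, smul_eq_mul, mul_one]
      refine max_le ?_ ?_
      · rw [dist_comm, Real.dist_eq, abs_of_nonneg (by linarith)]; linarith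
      · have : dist (β s) (β t) = ‖∫ r in s..t, γ' r‖ := by
          rw [dist_comm, dist_eq_norm]
          simp only [β, add_sub_add_left_eq_sub]
          rw [intervalIntegral.integral_interval_sub_left (hI _ ha _ ht) (hI _ ha _ hs)]
        rw [this]; linarith
    intro s hs t ht
    rcases le_total s t with hst | hst
    · exact key s hs t ht hst
    · rw [dist_comm, dist_comm (_ * _)]; exact key t ht s hs hst
  have hder := hac.integral_deriv_eq_sub
  have hz : ∀ t x, t ∉ Ioo a b → G (t, x) = 0 := by
    intro t x ht
    by_contra hne
    exact ht (hg3 (subset_tsupport _ hne)).1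
  rw [hz b _ (by simp), hz a _ (by simp), sub_zero] at hder
  have hcong : ∫ t in a..b, tIntegrand g (t, γ t, γ' t) =
      ∫ t in a..b, deriv (fun t => G (t, β t)) t := by
    apply intervalIntegral.integral_congr_ae
    filter_upwards [h.1.ae_hasDerivAt_integral] with t ht hmem
    have hmem' : t ∈ uIcc a b := uIoc_subset_uIcc hmem
    have h3 := ht hmem' a (by simp)
    have h4 : HasDerivAt (fun t => (t, β t)) ((1 : ℝ), γ' t) t :=
      (hasDerivAt_id _).prodMk (h3.const_add (γ a))
    have h5 : γ t = β t := h.2 t (by rwa [uIcc_of_le hab.le] at hmem')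
    have h6 : HasFDerivAt G (fderiv ℝ G (t, β t)) (t, β t) :=
      (hg1.differentiable (by simp) _).hasFDerivAt
    have h7 := h6.comp_hasDerivAt t h4
    rw [tIntegrand_eq (hg1.differentiable (by simp) _), h5]
    exact h7.deriv.symm
  rw [hcong, hder, mul_zero]


/-- Cost of the control `w` started at `(t,x)`. -/
def Jc (f : ℝ × E × E → ℝ) (b t : ℝ) (x : E) (w : ℝ → E) : ℝ :=
  ∫ s in t..b, f (s, x + ∫ r in t..s, w r, w s)

/-- Value function. -/
def uval (f : ℝ × E × E → ℝ) (b t : ℝ) (x : E) : ℝ :=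
  ⨅ w : {w : ℝ → E // Integrable w}, Jc f b t x w.1

lemma cost_ii {f : ℝ × E × E → ℝ} (hf : Continuous f) {C : ℝ}
    (hC : ∀ p, |f p| ≤ C * (1 + ‖p.2.2‖)) {w : ℝ → E} (hw : Integrable w) (t : ℝ) (x : E)
    (p q : ℝ) :
    IntervalIntegrable (fun s => f (s, x + ∫ r in t..s, w r, w s)) volume p q := by
  have h1 : Continuous (fun s => ∫ r in t..s, w r) :=
    intervalIntegral.continuous_primitive (fun _ _ => hw.intervalIntegrable) t
  have h2 : IntervalIntegrable (fun s => C * (1 + ‖w s‖)) volume p q :=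
    (intervalIntegrable_const.add hw.norm.intervalIntegrable).const_mul _
  refine h2.mono_fun' ?_ ?_
  · have : AEMeasurable (fun s => (s, x + ∫ r in t..s, w r, w s)) volume :=
      aemeasurable_id.prodMk ((continuous_const.add h1).aemeasurable.prodMk hw.aemeasurable)
    exact (hf.measurable.comp_aemeasurable this).aestronglyMeasurable.restrict
  · exact Eventually.of_forall fun s => hC _

/-- Concatenation of a segment with velocity `v` on `[t,t']` with `w`. -/
def catw (t t' : ℝ) (v : E) (w : ℝ → E) : ℝ → E :=
  fun s => (Ioc t t').indicator (fun _ => v) s + (Ioi t').indicator w s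

lemma catw_integrable (t t' : ℝ) (v : E) {w : ℝ → E} (hw : Integrable w) :
    Integrable (catw t t' v w) := by
  refine Integrable.add ?_ (hw.indicator measurableSet_Ioi)
  rw [integrable_indicator_iff measurableSet_Ioc]
  exact integrableOn_const (by simp)

lemma catw_left {t t' s : ℝ} (v : E) (w : ℝ → E) (h : s ∈ Ioc t t') : catw t t' v w s = v := by
  simp [catw, h, not_lt.2 h.2]
  
lemma catw_right {t t' s : ℝ} (v : E) (w : ℝ → E) (h : t' < s) : catw t t' v w s = w s := by
  simp [catw, h, not_le.2 h]

lemma catw_prim_left {t t' s : ℝ} (v : E) (w : ℝ → E) (h : s ∈ Icc t t') :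
    ∫ r in t..s, catw t t' v w r = (s - t) • v := by
  rw [← intervalIntegral.integral_const]
  apply intervalIntegral.integral_congr_ae
  refine Eventually.of_forall fun r hr => ?_
  rw [uIoc_of_le h.1] at hr
  exact catw_left v w ⟨hr.1, hr.2.trans h.2⟩

lemma catw_prim_right {t t' s : ℝ} (htt : t ≤ t') (v : E) {w : ℝ → E} (hw : Integrable w)
    (h : t' ≤ s) :
    ∫ r in t..s, catw t t' v w r = (t' - t) • v + ∫ r in t'..s, w r := by
  have hc := catw_integrable t t' v hw
  rw [← intervalIntegral.integral_add_adjacent_intervals (b := t') hc.intervalIntegrable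
    hc.intervalIntegrable, catw_prim_left v w ⟨htt, le_rfl⟩]
  congr 1
  apply intervalIntegral.integral_congr_ae
  refine Eventually.of_forall fun r hr => ?_
  rw [uIoc_of_le h] at hr
  exact catw_right v w hr.1

lemma Jc_cat {f : ℝ × E × E → ℝ} (hf : Continuous f) {C : ℝ}
    (hC : ∀ p, |f p| ≤ C * (1 + ‖p.2.2‖)) {w : ℝ → E} (hw : Integrable w) {t t' b : ℝ} (x v : E)
    (h1 : t ≤ t') (h2 : t' ≤ b) :
    Jc f b t x (catw t t' v w) =
      (∫ s in t..t', f (s, x + (s - t) • v, v)) + Jc f b t' (x + (t' - t) • v) w := by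
  have hc := catw_integrable t t' v hw
  unfold Jc
  rw [← intervalIntegral.integral_add_adjacent_intervals (b := t') (cost_ii hf hC hc _ _ _ _)
    (cost_ii hf hC hc _ _ _ _)]
  congr 1
  · apply intervalIntegral.integral_congr_ae
    refine Eventually.of_forall fun r hr => ?_
    rw [uIoc_of_le h1] at hr
    rw [catw_left v w hr, catw_prim_left v w (Ioc_subset_Icc_self hr)]
  · apply intervalIntegral.integral_congr_ae
    refine Eventually.of_forall fun r hr => ?_
    rw [uIoc_of_le h2] at hr
    rw [catw_right v w hr.1, catw_prim_right h1 v hw hr.1.le, add_assoc]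

/-- Standing assumptions on the Lagrangian. -/
structure LagOK (a b : ℝ) (f : ℝ × E × E → ℝ) (C M : ℝ) : Prop where
  uc : UniformContinuous f
  bd : ∀ p, |f p| ≤ C * (1 + ‖p.2.2‖)
  lb : ∀ γ γ' : ℝ → E, IsACCurve a b γ γ' → M ≤ ∫ t in a..b, f (t, γ t, γ' t)

namespace LagOK

variable {a b : ℝ} {f : ℝ × E × E → ℝ} {C M : ℝ}

lemma C_nonneg (h : LagOK a b f C M) : 0 ≤ C := by
  have := h.bd (0, 0, 0)
  simp at this
  exact (abs_nonneg _).trans this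

lemma seg_le (h : LagOK a b f C M) {t t' : ℝ} (ht : t ≤ t') (x : E) :
    ∫ s in t..t', f (s, x + (s - t) • (0 : E), 0) ≤ C * (t' - t) := by
  have h1 := intervalIntegral.norm_integral_le_of_norm_le_const (a := t) (b := t')
    (f := fun s => f (s, x + (s - t) • (0 : E), 0)) (C := C) (fun s _ => by
      have := h.bd (s, x + (s - t) • (0 : E), 0)
      simpa using this)
  rw [abs_of_nonneg (by linarith)] at h1
  exact (le_abs_self _).trans h1

lemma J_ge (h : LagOK a b f C M) {t : ℝ} (ht : t ∈ Icc a b) (x : E) {w : ℝ → E}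
    (hw : Integrable w) : M - C * (t - a) ≤ Jc f b t x w := by
  have h1 := Jc_cat h.uc.continuous h.bd hw x 0 ht.1 ht.2
  have h2 := h.seg_le ht.1 x
  have h3 : M ≤ Jc f b a x (catw a t 0 w) := by
    have := h.lb (fun s => x + ∫ r in a..s, catw a t 0 w r) (catw a t 0 w)
      ⟨(catw_integrable a t 0 hw).intervalIntegrable, fun t _ => by simp⟩
    exact this
  rw [smul_zero, add_zero] at h1
  linarith

lemma J_bdd (h : LagOK a b f C M) {t : ℝ} (ht : t ∈ Icc a b) (x : E) :
    BddBelow (range fun w : {w : ℝ → E // Integrable w} => Jc f b t x w.1) :=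
  ⟨M - C * (t - a), by rintro _ ⟨w, rfl⟩; exact h.J_ge ht x w.2⟩

lemma u_ge (h : LagOK a b f C M) {t : ℝ} (ht : t ∈ Icc a b) (x : E) :
    M - C * (t - a) ≤ uval f b t x := by
  have : Nonempty {w : ℝ → E // Integrable w} := ⟨⟨0, integrable_zero _ _ _⟩⟩
  exact le_ciInf fun w => h.J_ge ht x w.2

lemma u_le (h : LagOK a b f C M) {t : ℝ} (ht : t ∈ Icc a b) (x : E) :
    uval f b t x ≤ C * (b - t) := by
  refine (ciInf_le (h.J_bdd ht x) ⟨0, integrable_zero _ _ _⟩).trans ?_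
  have := h.seg_le ht.2 x
  simpa [Jc] using this

lemma u_dpp (h : LagOK a b f C M) {t t' : ℝ} (h1 : a ≤ t) (h2 : t ≤ t') (h3 : t' ≤ b) (x v : E) :
    uval f b t x ≤ (∫ s in t..t', f (s, x + (s - t) • v, v)) +
      uval f b t' (x + (t' - t) • v) := by
  have : Nonempty {w : ℝ → E // Integrable w} := ⟨⟨0, integrable_zero _ _ _⟩⟩
  rw [← sub_le_iff_le_add']
  refine le_ciInf fun w => ?_
  rw [sub_le_iff_le_add', ← Jc_cat h.uc.continuous h.bd w.2 x v h2 h3]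
  exact ciInf_le (h.J_bdd ⟨h1, h2.trans h3⟩ x) ⟨_, catw_integrable t t' v w.2⟩

lemma u_mono (h : LagOK a b f C M) {t t' : ℝ} (h1 : a ≤ t) (h2 : t ≤ t') (h3 : t' ≤ b) (x : E) :
    uval f b t x ≤ C * (t' - t) + uval f b t' x := by
  have := h.u_dpp h1 h2 h3 x 0
  rw [smul_zero, add_zero] at this
  linarith [h.seg_le h2 x]

lemma u_close (h : LagOK a b f C M) {t : ℝ} (ht : t ∈ Icc a b) {κ δ : ℝ} 
    (hκ : ∀ p q : ℝ × E × E, dist p q < δ → dist (f p) (f q) ≤ κ) {x y : E} (hxy : dist x y < δ) :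
    uval f b t x ≤ uval f b t y + κ * (b - t) := by
  have : Nonempty {w : ℝ → E // Integrable w} := ⟨⟨0, integrable_zero _ _ _⟩⟩
  rw [← sub_le_iff_le_add]
  refine le_ciInf fun w => ?_
  rw [sub_le_iff_le_add]
  refine (ciInf_le (h.J_bdd ht x) w).trans ?_
  unfold Jc
  rw [← sub_le_iff_le_add', ← intervalIntegral.integral_sub (cost_ii h.uc.continuous h.bd w.2 _ _ _ _)
    (cost_ii h.uc.continuous h.bd w.2 _ _ _ _)]
  have h1 := intervalIntegral.norm_integral_le_of_norm_le_const (a := t) (b := b)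
    (f := fun s => f (s, x + ∫ r in t..s, w.1 r, w.1 s) - f (s, y + ∫ r in t..s, w.1 r, w.1 s))
    (C := κ) (fun s _ => by
      rw [← dist_eq_norm]
      apply hκ
      simp only [Prod.dist_eq, dist_self, dist_add_right]
      simpa using hxy)
  rw [abs_of_nonneg (by linarith [ht.2])] at h1
  exact (le_abs_self _).trans h1

lemma u_cont (h : LagOK a b f C M) {t : ℝ} (ht : t ∈ Icc a b) : Continuous (uval f b t) := by
  rw [Metric.continuous_iff']
  intro x ε hε
  have hb : 0 ≤ b - t := by linarith [ht.2]
  set κ := ε / (2 * (b - t + 1)) with hκ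
  have hκ0 : 0 < κ := by positivity
  have hκ1 : κ * (b - t) < ε := by
    rw [hκ, div_mul_eq_mul_div, div_lt_iff₀ (by positivity)]
    nlinarith
  obtain ⟨δ, hδ, hd⟩ := Metric.uniformContinuous_iff.1 h.uc κ hκ0
  filter_upwards [Metric.ball_mem_nhds x hδ] with y hy
  have e1 := h.u_close ht (fun p q hpq => (hd hpq).le) hy
  have e2 := h.u_close ht (fun p q hpq => (hd hpq).le) (by rw [dist_comm]; exact hy)
  rw [Real.dist_eq, abs_lt]
  constructor <;> linarith

end LagOK

/-- Clamped value function. -/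
def Ucl (f : ℝ × E × E → ℝ) (a b : ℝ) (z : ℝ × E) : ℝ := uval f b (max a (min z.1 b)) z.2

namespace LagOK
variable {a b : ℝ} {f : ℝ × E × E → ℝ} {C M : ℝ}

lemma clamp_mem (hab : a < b) (t : ℝ) : max a (min t b) ∈ Icc a b :=
  ⟨le_max_left _ _, max_le hab.le (min_le_right _ _)⟩

lemma U_meas_t (hab : a < b) (h : LagOK a b f C M) (x : E) :
    Measurable (fun t : ℝ => uval f b (max a (min t b)) x) := by
  have hm : Monotone (fun t : ℝ => uval f b (max a (min t b)) x + C * max a (min t b)) := by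
    intro s t hst
    have := h.u_mono (t := max a (min s b)) (t' := max a (min t b)) (le_max_left _ _)
      (max_le_max le_rfl (min_le_min hst le_rfl)) (clamp_mem hab t).2 x
    simp only
    linarith
  have hc : Measurable (fun t : ℝ => C * max a (min t b)) := by fun_prop
  have := hm.measurable.sub hc
  have e : (fun t : ℝ => uval f b (max a (min t b)) x) =
      ((fun t => uval f b (max a (min t b)) x + C * max a (min t b)) -
        fun t => C * max a (min t b)) := by
    funext t
    simp only [Pi.sub_apply, add_sub_cancel_right]
  rw [e]
  exact this

lemma U_meas (hab : a < b) (h : LagOK a b f C M) : Measurable (Ucl f a b) := by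
  have h1 : Measurable (Function.uncurry fun (x : E) (t : ℝ) => uval f b (max a (min t b)) x) :=
    measurable_uncurry_of_continuous_of_measurable
      (u := fun (x : E) (t : ℝ) => uval f b (max a (min t b)) x)
      (fun t => h.u_cont (clamp_mem hab t)) (fun x => h.U_meas_t hab x)
  have e : Ucl f a b = fun z : ℝ × E =>
    (Function.uncurry fun (x : E) (t : ℝ) => uval f b (max a (min t b)) x) (z.2, z.1) := rfl
  rw [e]
  exact h1.comp (measurable_snd.prodMk measurable_fst)

lemma U_eq {t : ℝ} (ht : t ∈ Icc a b) (x : E) : Ucl f a b (t, x) = uval f b t x := by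
  simp [Ucl, ht.1, ht.2]

lemma U_bdd (hab : a < b) (h : LagOK a b f C M) : ∃ K, ∀ z, |Ucl f a b z| ≤ K := by
  refine ⟨|M| + C * (b - a), fun z => ?_⟩
  have hz := clamp_mem hab z.1
  have h1 := h.u_ge hz z.2
  have h2 := h.u_le hz z.2
  have hC := h.C_nonneg
  have h3 : C * (max a (min z.1 b) - a) ≤ C * (b - a) :=
    mul_le_mul_of_nonneg_left (by linarith [hz.2]) hC
  have h4 : C * (b - max a (min z.1 b)) ≤ C * (b - a) :=
    mul_le_mul_of_nonneg_left (by linarith [hz.1]) hC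
  unfold Ucl
  rw [abs_le]
  constructor
  · linarith [neg_abs_le M]
  · linarith [abs_nonneg M]

end LagOK

lemma exists_mollifier {ε : ℝ} (hε : 0 < ε) : ∃ ρ : ℝ × E → ℝ, ContDiff ℝ (⊤ : ℕ∞) ρ ∧
    HasCompactSupport ρ ∧ (∀ z, 0 ≤ ρ z) ∧ (∀ z, ε ≤ ‖z‖ → ρ z = 0) ∧
    ∫ z, ρ z ∂(Measure.addHaar : Measure (ℝ × E)) = 1 := by
  let φ : ContDiffBump (0 : ℝ × E) := ⟨ε / 2, ε, by positivity, by linarith⟩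
  refine ⟨φ.normed Measure.addHaar, φ.contDiff_normed, φ.hasCompactSupport_normed,
    φ.nonneg_normed, fun z hz => ?_, φ.integral_normed⟩
  by_contra hne
  have : z ∈ Function.support (φ.normed (Measure.addHaar : Measure (ℝ × E))) := hne
  rw [φ.support_normed_eq] at this
  have h2 : ‖z‖ < ε := by simpa using this
  linarith

lemma moll_integrable {ρ φ : ℝ × E → ℝ} (h1 : ContDiff ℝ (⊤ : ℕ∞) ρ) (h2 : HasCompactSupport ρ)
    (hm : Measurable φ) {K : ℝ} (hK : ∀ z, |φ z| ≤ K) :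
    Integrable (fun z => ρ z * φ z) (Measure.addHaar : Measure (ℝ × E)) := by
  have h3 : Integrable ρ (Measure.addHaar : Measure (ℝ × E)) :=
    h1.continuous.integrable_of_hasCompactSupport h2
  exact h3.mul_bdd (c := K) hm.aestronglyMeasurable (Eventually.of_forall hK)

lemma moll_mono {ρ φ ψ : ℝ × E → ℝ} {ε : ℝ} 
    (h3 : ∀ z, 0 ≤ ρ z) (h4 : ∀ z, ε ≤ ‖z‖ → ρ z = 0)
    (hφ : Integrable (fun z => ρ z * φ z) (Measure.addHaar : Measure (ℝ × E)))
    (hψ : Integrable (fun z => ρ z * ψ z) (Measure.addHaar : Measure (ℝ × E)))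
    (h : ∀ z, ‖z‖ < ε → φ z ≤ ψ z) :
    ∫ z, ρ z * φ z ∂(Measure.addHaar : Measure (ℝ × E)) ≤
      ∫ z, ρ z * ψ z ∂(Measure.addHaar : Measure (ℝ × E)) := by
  refine integral_mono hφ hψ fun z => ?_
  simp only
  rcases lt_or_ge ‖z‖ ε with hz | hz
  · exact mul_le_mul_of_nonneg_left (h z hz) (h3 z)
  · rw [h4 z hz]; simp

lemma exists_smooth {a b : ℝ} {f : ℝ × E × E → ℝ} {C M : ℝ} (hab : a < b)
    (h : LagOK a b f C M) {κ δ : ℝ} (hκ : 0 < κ) (hδ : 0 < δ) :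
    ∃ g : ℝ × E → ℝ, ContDiff ℝ (⊤ : ℕ∞) g ∧ (∃ K, ∀ z, |g z| ≤ K) ∧
      (∀ t ∈ Icc (a + δ) (b - δ), ∀ x v,
        0 ≤ fderiv ℝ g (t, x) (1, v) + f (t, x, v) + κ) ∧
      (∀ t ∈ Icc (a + δ) (b - δ), ∀ x,
        M - C * (t + δ - a) ≤ g (t, x) ∧ g (t, x) ≤ C * (b - t + δ)) := by
  obtain ⟨δ', hδ', hd⟩ := Metric.uniformContinuous_iff.1 h.uc κ hκ
  set ε := min (δ / 2) (δ' / 2) with hεdef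
  have hε : 0 < ε := by positivity
  have hε1 : ε ≤ δ / 2 := min_le_left _ _
  have hε2 : ε ≤ δ' / 2 := min_le_right _ _
  obtain ⟨ρ, r1, r2, r3, r4, r5⟩ := exists_mollifier (E := E) hε
  obtain ⟨K, hK⟩ := h.U_bdd hab
  have hUm := h.U_meas hab
  set U := Ucl f a b with hU
  set μ : Measure (ℝ × E) := Measure.addHaar with hμ
  have hUloc : LocallyIntegrable U μ := by
    refine (locallyIntegrable_const K).mono hUm.aestronglyMeasurable ?_
    exact Eventually.of_forall fun z => (hK z).trans (le_abs_self _)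
  let g : ℝ × E → ℝ := fun z => ∫ y, ρ y * U (z - y) ∂μ
  have hg : ContDiff ℝ (⊤ : ℕ∞) g :=
    HasCompactSupport.contDiff_convolution_left (ContinuousLinearMap.mul ℝ ℝ) r2 r1 hUloc
  have hItg : ∀ z, Integrable (fun y => ρ y * U (z - y)) μ := fun z =>
    moll_integrable r1 r2 (hUm.comp (measurable_const.sub measurable_id)) (fun y => hK _)
  have hintc : ∀ c : ℝ, Integrable (fun y => ρ y * c) μ := fun c =>
    moll_integrable r1 r2 measurable_const (fun y => le_rfl)
  have hc : ∀ c : ℝ, ∫ y, ρ y * c ∂μ = c := fun c => by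
    rw [integral_mul_const, r5, one_mul]
  have hge : ∀ z c, (∀ y, ‖y‖ < ε → c ≤ U (z - y)) → c ≤ g z := fun z c hzc => by
    rw [← hc c]
    exact moll_mono r3 r4 (hintc c) (hItg z) hzc
  have hle : ∀ z c, (∀ y, ‖y‖ < ε → U (z - y) ≤ c) → g z ≤ c := fun z c hzc => by
    rw [← hc c]
    exact moll_mono r3 r4 (hItg z) (hintc c) hzc
  have hC0 := h.C_nonneg
  have hy : ∀ y : ℝ × E, ‖y‖ < ε → -ε < y.1 ∧ y.1 < ε ∧ ‖y.2‖ < ε := by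
    intro y hy
    have e1 := (norm_fst_le y).trans_lt hy
    have e2 := (norm_snd_le y).trans_lt hy
    rw [Real.norm_eq_abs, abs_lt] at e1
    exact ⟨e1.1, e1.2, e2⟩
  refine ⟨g, hg, ⟨K, fun z => ?_⟩, ?_, ?_⟩
  · rw [abs_le]
    exact ⟨hge z _ fun y _ => (abs_le.1 (hK _)).1, hle z _ fun y _ => (abs_le.1 (hK _)).2⟩
  · intro t ht x v
    have hder : HasDerivAt (fun s : ℝ => g ((t, x) + s • (1, v))) (fderiv ℝ g (t, x) (1, v)) 0 := by
      have e1 : HasFDerivAt g (fderiv ℝ g (t, x)) ((t, x) + (0 : ℝ) • ((1 : ℝ), v)) := by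
        rw [zero_smul, add_zero]
        exact (hg.differentiable (by simp) _).hasFDerivAt
      have e2 : HasDerivAt (fun s : ℝ => (t, x) + s • ((1 : ℝ), v)) ((1 : ℝ), v) 0 := by
        have := ((hasDerivAt_id (0 : ℝ)).smul_const ((1 : ℝ), v)).const_add (t, x)
        simpa using this
      exact e1.comp_hasDerivAt (0 : ℝ) e2
    have hlim := hder.tendsto_slope_zero_right
    suffices hs : -(f (t, x, v) + κ) ≤ fderiv ℝ g (t, x) (1, v) by linarith
    refine ge_of_tendsto hlim ?_
    have hh0 : 0 < min (δ / 2) (δ' / 2 / (1 + ‖v‖)) := by positivity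
    filter_upwards [Ioo_mem_nhdsGT hh0] with s hs
    have hs1 : s < δ / 2 := hs.2.trans_le (min_le_left _ _)
    have hs2 : s * (1 + ‖v‖) < δ' / 2 := by
      have := hs.2.trans_le (min_le_right _ _)
      rwa [lt_div_iff₀ (by positivity)] at this
    have hs0 : 0 < s := hs.1
    rw [zero_add, zero_smul, add_zero, smul_eq_mul, inv_mul_eq_div, le_div_iff₀ hs0]
    have key : ∫ y, ρ y * (U ((t, x) - y)) ∂μ ≤
        ∫ y, ρ y * (U ((t, x) + s • ((1 : ℝ), v) - y) + s * (f (t, x, v) + κ)) ∂μ := by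
      refine moll_mono r3 r4 (hItg _) ?_ ?_
      · simp only [mul_add (ρ _) (U _)]
        exact (hItg _).add (hintc _)
      · intro y hyε
        obtain ⟨y1, y2, y3⟩ := hy y hyε
        have m1 : a ≤ t - y.1 := by linarith [ht.1]
        have m2 : t - y.1 ≤ t - y.1 + s := by linarith
        have m3 : t - y.1 + s ≤ b := by linarith [ht.2]
        have d := h.u_dpp m1 m2 m3 (x - y.2) v
        have i1 : U ((t, x) - y) = uval f b (t - y.1) (x - y.2) :=
          LagOK.U_eq ⟨m1, m2.trans m3⟩ _
        have i2 : U ((t, x) + s • ((1 : ℝ), v) - y) =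
            uval f b (t - y.1 + s) (x - y.2 + (t - y.1 + s - (t - y.1)) • v) := by
          rw [← LagOK.U_eq (a := a) ⟨m1.trans m2, m3⟩]
          congr 1
          ext1
          · simp; ring
          · simp; abel
        rw [i1, i2]
        have hi : ∫ r in (t - y.1)..(t - y.1 + s), f (r, x - y.2 + (r - (t - y.1)) • v, v) ≤
            s * (f (t, x, v) + κ) := by
          have e : s * (f (t, x, v) + κ) =
              ∫ r in (t - y.1)..(t - y.1 + s), (f (t, x, v) + κ) := by
            rw [intervalIntegral.integral_const, smul_eq_mul]
            ring
          rw [e]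
          refine intervalIntegral.integral_mono_on m2 ?_ intervalIntegrable_const ?_
          · apply Continuous.intervalIntegrable
            exact h.uc.continuous.comp (by fun_prop)
          · intro r hr
            have hr1 := hr.1
            have hr2 := hr.2
            have hdist : dist (r, x - y.2 + (r - (t - y.1)) • v, v) (t, x, v) < δ' := by
              have hv := norm_nonneg v
              have sv : 0 ≤ s * ‖v‖ := by positivity
              have hsv : s * (1 + ‖v‖) = s + s * ‖v‖ := by ring
              rw [Prod.dist_eq, Prod.dist_eq]
              simp only [dist_self]
              refine max_lt ?_ (max_lt ?_ hδ')
              · rw [Real.dist_eq, abs_lt]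
                constructor <;> linarith
              · rw [dist_eq_norm]
                have : x - y.2 + (r - (t - y.1)) • v - x = -y.2 + (r - (t - y.1)) • v := by abel
                rw [this]
                refine (norm_add_le _ _).trans_lt ?_
                rw [norm_neg, norm_smul, Real.norm_eq_abs, abs_of_nonneg (by linarith)]
                have : (r - (t - y.1)) * ‖v‖ ≤ s * ‖v‖ :=
                  mul_le_mul_of_nonneg_right (by linarith) hv
                linarith
            have := hd hdist
            rw [Real.dist_eq, abs_lt] at this
            linarith [this.2]
        linarith
    have split : ∫ y, ρ y * (U ((t, x) + s • ((1 : ℝ), v) - y) + s * (f (t, x, v) + κ)) ∂μ =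
        g ((t, x) + s • ((1 : ℝ), v)) + s * (f (t, x, v) + κ) := by
      simp only [mul_add (ρ _) (U _)]
      rw [integral_add (hItg _) (hintc _), hc]
    rw [split] at key
    have : g (t, x) ≤ g ((t, x) + s • ((1 : ℝ), v)) + s * (f (t, x, v) + κ) := key
    linarith
  · intro t ht x
    have main : ∀ y : ℝ × E, ‖y‖ < ε →
        M - C * (t + δ - a) ≤ U ((t, x) - y) ∧ U ((t, x) - y) ≤ C * (b - t + δ) := by
      intro y hyε
      obtain ⟨y1, y2, y3⟩ := hy y hyε
      have m : t - y.1 ∈ Icc a b := ⟨by linarith [ht.1], by linarith [ht.2]⟩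
      have i1 : U ((t, x) - y) = uval f b (t - y.1) (x - y.2) := LagOK.U_eq m _
      rw [i1]
      have u1 := h.u_ge m (x - y.2)
      have u2 := h.u_le m (x - y.2)
      have e1 : C * (t - y.1 - a) ≤ C * (t + δ - a) :=
        mul_le_mul_of_nonneg_left (by linarith) hC0
      have e2 : C * (b - (t - y.1)) ≤ C * (b - t + δ) :=
        mul_le_mul_of_nonneg_left (by linarith) hC0
      constructor <;> linarith
    exact ⟨hge _ _ fun y hy => (main y hy).1, hle _ _ fun y hy => (main y hy).2⟩

lemma exists_cutoffs : ∃ (χ : ℕ → E → ℝ) (L : ℝ), 0 ≤ L ∧ (∀ n, ContDiff ℝ (⊤ : ℕ∞) (χ n)) ∧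
    (∀ n x, 0 ≤ χ n x) ∧ (∀ n x, χ n x ≤ 1) ∧
    (∀ (n : ℕ) x, 2 * ((n : ℝ) + 1) < ‖x‖ → χ n x = 0) ∧
    (∀ (n : ℕ) x v, |fderiv ℝ (χ n) x v| ≤ L * ((n : ℝ) + 1)⁻¹ * ‖v‖) ∧
    (∀ x, Tendsto (fun n => χ n x) atTop (𝓝 1)) := by
  let φ : ContDiffBump (0 : E) := ⟨1, 2, by norm_num, by norm_num⟩
  have hφ : ContDiff ℝ (⊤ : ℕ∞) φ := φ.contDiff
  obtain ⟨L, hL⟩ := hφ.lipschitzWith_of_hasCompactSupport φ.hasCompactSupport (by simp)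
  have hd : ∀ x v, |fderiv ℝ φ x v| ≤ L * ‖v‖ := fun x v =>
    ContinuousLinearMap.le_of_opNorm_le _ (norm_fderiv_le_of_lipschitz ℝ hL) v
  refine ⟨fun n x => φ (((n : ℝ) + 1)⁻¹ • x), L, L.coe_nonneg, fun n => ?_, fun n x => φ.nonneg,
    fun n x => φ.le_one, fun n x hx => ?_, fun n x v => ?_, fun x => ?_⟩
  · exact hφ.comp (contDiff_const_smul _)
  · apply φ.zero_of_le_dist
    have hn : (0 : ℝ) < (n : ℝ) + 1 := by positivity
    rw [dist_zero_right, norm_smul, norm_inv, Real.norm_eq_abs, abs_of_pos hn, inv_mul_eq_div,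
      le_div_iff₀ hn]
    exact hx.le
  · have hn : (0 : ℝ) < (n : ℝ) + 1 := by positivity
    have h1 : HasFDerivAt (fun y : E => ((n : ℝ) + 1)⁻¹ • y)
        (((n : ℝ) + 1)⁻¹ • ContinuousLinearMap.id ℝ E) x :=
      (hasFDerivAt_id x).const_smul _
    have h2 : HasFDerivAt φ (fderiv ℝ φ (((n : ℝ) + 1)⁻¹ • x)) (((n : ℝ) + 1)⁻¹ • x) :=
      (hφ.differentiable (by simp) _).hasFDerivAt
    have h3 : HasFDerivAt (fun x => φ (((n : ℝ) + 1)⁻¹ • x)) _ x := h2.comp x h1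
    rw [h3.fderiv]
    simp only [ContinuousLinearMap.comp_apply, ContinuousLinearMap.smul_apply,
      ContinuousLinearMap.id_apply]
    refine (hd _ _).trans ?_
    rw [norm_smul, norm_inv, Real.norm_eq_abs, abs_of_pos hn, mul_assoc]
  · obtain ⟨N, hN⟩ := exists_nat_ge ‖x‖
    refine tendsto_const_nhds.congr' ?_
    filter_upwards [eventually_ge_atTop N] with n hn
    symm
    apply φ.one_of_mem_closedBall
    have hn' : (N : ℝ) ≤ n := by exact_mod_cast hn
    have hn1 : (0 : ℝ) < (n : ℝ) + 1 := by positivity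
    rw [mem_closedBall_zero_iff, norm_smul, norm_inv, Real.norm_eq_abs, abs_of_pos hn1,
      inv_mul_eq_div, div_le_iff₀ hn1]
    change _ ≤ 1 * _
    linarith

lemma cutoff_ineq {a b : ℝ} {f : ℝ × E × E → ℝ} {C : ℝ} (hf : Continuous f)
    (hC : ∀ p, |f p| ≤ C * (1 + ‖p.2.2‖)) {η : Measure (ℝ × E × E)} (hη : IsTransport a b η)
    {κ δ : ℝ} (hδ : 0 < δ)
    {g : ℝ × E → ℝ} (hg : ContDiff ℝ (⊤ : ℕ∞) g) {K : ℝ} (hK : ∀ z, |g z| ≤ K)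
    (hd : ∀ t ∈ Icc (a + δ) (b - δ), ∀ x v, 0 ≤ fderiv ℝ g (t, x) (1, v) + f (t, x, v) + κ)
    {ψ : ℝ → ℝ} (hψ : ContDiff ℝ (⊤ : ℕ∞) ψ) (h0 : ∀ t, 0 ≤ ψ t) (h1 : ∀ t, ψ t ≤ 1)
    (hs : ∀ t, t ∉ Icc (a + δ) (b - δ) → ψ t = 0) :
    ∫ p, (deriv ψ p.1 * g (p.1, p.2.1) - ψ p.1 * (f p + κ)) ∂η ≤ 0 := by
  obtain ⟨χ, L, hL, c1, c2, c3, c4, c5, c6⟩ := exists_cutoffs (E := E)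
  have hprob : IsProbabilityMeasure η := hη.1.1
  have hK0 : 0 ≤ K := (abs_nonneg _).trans (hK 0)
  have hψc : HasCompactSupport ψ := HasCompactSupport.intro isCompact_Icc hs
  have hψ' : Continuous (deriv ψ) := hψ.continuous_deriv (by simp)
  obtain ⟨D, hD⟩ : ∃ D, ∀ t, |deriv ψ t| ≤ D := by
    obtain ⟨Q, hQ⟩ := hψ.lipschitzWith_of_hasCompactSupport hψc (by simp)
    exact ⟨Q, fun t => norm_deriv_le_of_lipschitz hQ⟩
  have hD0 : 0 ≤ D := (abs_nonneg _).trans (hD 0)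
  let F : ℕ → ℝ × E × E → ℝ := fun n p =>
    deriv ψ p.1 * (χ n p.2.1 * g (p.1, p.2.1)) - ψ p.1 * χ n p.2.1 * (f p + κ)
      - K * (L * ((n : ℝ) + 1)⁻¹) * ‖p.2.2‖
  have hFc : ∀ n, Continuous (F n) := by
    intro n
    have := (c1 n).continuous
    have := hg.continuous
    have := hψ.continuous
    fun_prop
  have hn1 : ∀ n : ℕ, ((n : ℝ) + 1)⁻¹ ≤ 1 := fun n =>
    inv_le_one_of_one_le₀ (by linarith [(Nat.cast_nonneg n : (0 : ℝ) ≤ n)])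
  have hFb : ∀ n p, |F n p| ≤ (D * K + C + |κ| + K * L) * (1 + ‖p.2.2‖) := by
    intro n p
    have hv := norm_nonneg p.2.2
    have hi : 0 ≤ ((n : ℝ) + 1)⁻¹ := by positivity
    have b1 : |deriv ψ p.1 * (χ n p.2.1 * g (p.1, p.2.1))| ≤ D * K := by
      rw [abs_mul, abs_mul, abs_of_nonneg (c2 n _)]
      refine mul_le_mul (hD _) ?_ (by positivity [c2 n p.2.1]) hD0
      calc _ ≤ 1 * K := mul_le_mul (c3 _ _) (hK _) (abs_nonneg _) zero_le_one
        _ = K := one_mul _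
    have b2 : |ψ p.1 * χ n p.2.1 * (f p + κ)| ≤ C * (1 + ‖p.2.2‖) + |κ| := by
      rw [abs_mul, abs_mul, abs_of_nonneg (c2 n _), abs_of_nonneg (h0 _)]
      calc _ ≤ 1 * 1 * |f p + κ| := by
            gcongr
            · exact c2 _ _
            · exact h1 _
            · exact c3 _ _
        _ ≤ _ := by
            rw [one_mul, one_mul]
            exact (abs_add_le _ _).trans (by linarith [hC p])
    have b3 : |K * (L * ((n : ℝ) + 1)⁻¹) * ‖p.2.2‖| ≤ K * L * ‖p.2.2‖ := by
      rw [abs_of_nonneg (by positivity)]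
      have : L * ((n : ℝ) + 1)⁻¹ ≤ L := mul_le_of_le_one_right hL (hn1 n)
      gcongr
    have b4 : |F n p| ≤ _ := (abs_sub _ _).trans (add_le_add ((abs_sub _ _).trans
      (add_le_add b1 b2)) b3)
    refine b4.trans ?_
    have : 0 ≤ D * K * ‖p.2.2‖ := by positivity
    have : 0 ≤ |κ| * ‖p.2.2‖ := by positivity
    have : 0 ≤ K * L := by positivity
    nlinarith
  have hle : ∀ n, ∫ p, F n p ∂η ≤ 0 := by
    intro n
    let G : ℝ → E → ℝ := fun t x => ψ t * (χ n x * g (t, x))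
    have hGs : ContDiff ℝ (⊤ : ℕ∞) (Function.uncurry G) := by
      have e1 : ContDiff ℝ (⊤ : ℕ∞) (fun z : ℝ × E => ψ z.1) := hψ.comp contDiff_fst
      have e2 : ContDiff ℝ (⊤ : ℕ∞) (fun z : ℝ × E => χ n z.2) := (c1 n).comp contDiff_snd
      exact e1.mul (e2.mul hg)
    have hG0 : ∀ z : ℝ × E, z.1 ∉ Icc (a + δ) (b - δ) → Function.uncurry G z = 0 := by
      intro z hz
      simp [Function.uncurry, G, hs z.1 hz]
    have hGc : HasCompactSupport (Function.uncurry G) := by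
      refine HasCompactSupport.intro (K := Icc (a + δ) (b - δ) ×ˢ
        Metric.closedBall (0 : E) (2 * ((n : ℝ) + 1)))
        (isCompact_Icc.prod (isCompact_closedBall _ _)) ?_
      intro z hz
      by_cases hz1 : z.1 ∈ Icc (a + δ) (b - δ)
      · have : z.2 ∉ Metric.closedBall (0 : E) (2 * ((n : ℝ) + 1)) := fun h => hz ⟨hz1, h⟩
        rw [mem_closedBall_zero_iff, not_le] at this
        simp [Function.uncurry, G, c4 n z.2 this]
      · exact hG0 z hz1
    have hGt : tsupport (Function.uncurry G) ⊆ Ioo a b ×ˢ (univ : Set E) := by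
      have : tsupport (Function.uncurry G) ⊆ Icc (a + δ) (b - δ) ×ˢ (univ : Set E) := by
        refine closure_minimal ?_ (isClosed_Icc.prod isClosed_univ)
        intro z hz
        refine ⟨?_, mem_univ _⟩
        by_contra h
        exact hz (hG0 z h)
      refine this.trans (prod_mono ?_ le_rfl)
      exact fun t ht => ⟨by linarith [ht.1], by linarith [ht.2]⟩
    have hzero := hη.2 G ⟨hGs, hGc, hGt⟩
    rw [← hzero]
    obtain ⟨B, hB⟩ := tIntegrand_bound hGs hGc
    refine integral_mono (young_integrable hη.1 (hFc n) (hFb n))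
      (young_integrable hη.1 (tIntegrand_cont hGs) hB) fun p => ?_
    obtain ⟨t, x, v⟩ := p
    have e1 : HasFDerivAt (fun z : ℝ × E => ψ z.1)
        ((deriv ψ t) • ContinuousLinearMap.fst ℝ ℝ E) (t, x) := by
      have : HasDerivAt ψ (deriv ψ t) (t, x).1 := (hψ.differentiable (by simp) t).hasDerivAt
      exact this.comp_hasFDerivAt (t, x) hasFDerivAt_fst
    have e2 : HasFDerivAt (fun z : ℝ × E => χ n z.2)
        ((fderiv ℝ (χ n) x).comp (ContinuousLinearMap.snd ℝ ℝ E)) (t, x) := by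
      have : HasFDerivAt (χ n) (fderiv ℝ (χ n) x) (t, x).2 :=
        ((c1 n).differentiable (by simp) x).hasFDerivAt
      exact this.comp (t, x) hasFDerivAt_snd
    have e3 : HasFDerivAt g (fderiv ℝ g (t, x)) (t, x) :=
      (hg.differentiable (by simp) _).hasFDerivAt
    have e4 : HasFDerivAt (Function.uncurry G) _ (t, x) := e1.mul (e2.mul e3)
    have e5 : tIntegrand G (t, x, v) = deriv ψ t * (χ n x * g (t, x)) +
        ψ t * (fderiv ℝ (χ n) x v * g (t, x)) + ψ t * χ n x * fderiv ℝ g (t, x) (1, v) := by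
      rw [tIntegrand_eq e4.differentiableAt, e4.fderiv]
      simp
      ring
    rw [e5]
    simp only [F]
    have q1 : -(K * (L * ((n : ℝ) + 1)⁻¹) * ‖v‖) ≤ ψ t * (fderiv ℝ (χ n) x v * g (t, x)) := by
      have : |ψ t * (fderiv ℝ (χ n) x v * g (t, x))| ≤ K * (L * ((n : ℝ) + 1)⁻¹) * ‖v‖ := by
        rw [abs_mul, abs_mul, abs_of_nonneg (h0 t)]
        calc _ ≤ 1 * ((L * ((n : ℝ) + 1)⁻¹ * ‖v‖) * K) := by
              gcongr
              · exact h1 _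
              · exact c5 _ _ _
              · exact hK _
          _ = _ := by ring
      exact (abs_le.1 this).1
    have q2 : -(ψ t * χ n x * (f (t, x, v) + κ)) ≤ ψ t * χ n x * fderiv ℝ g (t, x) (1, v) := by
      by_cases ht : t ∈ Icc (a + δ) (b - δ)
      · have := mul_nonneg (mul_nonneg (h0 t) (c2 n x)) (hd t ht x v)
        linarith
      · rw [hs t ht]; simp
    linarith
  have hlim : Tendsto (fun n => ∫ p, F n p ∂η) atTop
      (𝓝 (∫ p, (deriv ψ p.1 * g (p.1, p.2.1) - ψ p.1 * (f p + κ)) ∂η)) := by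
    refine tendsto_integral_of_dominated_convergence
      (fun p => (D * K + C + |κ| + K * L) * (1 + ‖p.2.2‖))
      (fun n => (hFc n).aestronglyMeasurable) ?_ (fun n => Eventually.of_forall (hFb n)) ?_
    · exact ((integrable_const _).add hη.1.2.2).const_mul _
    · refine Eventually.of_forall fun p => ?_
      have l1 := c6 p.2.1
      have l2 : Tendsto (fun n : ℕ => ((n : ℝ) + 1)⁻¹) atTop (𝓝 0) := by
        simpa using tendsto_one_div_add_atTop_nhds_zero_nat (𝕜 := ℝ)
      have l3 := (((l1.mul_const (g (p.1, p.2.1))).const_mul (deriv ψ p.1)).sub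
        ((l1.const_mul (ψ p.1)).mul_const (f p + κ))).sub
        (((l2.const_mul L).const_mul K).mul_const ‖p.2.2‖)
      simpa using l3
  exact le_of_tendsto' hlim hle

/-- Smooth step. -/
def stp (c δ t : ℝ) : ℝ := Real.smoothTransition ((t - c) / δ)

lemma stp_smooth (c δ : ℝ) : ContDiff ℝ (⊤ : ℕ∞) (stp c δ) :=
  Real.smoothTransition.contDiff.comp ((contDiff_id.sub contDiff_const).div_const _)

lemma stp_zero {c δ t : ℝ} (hδ : 0 < δ) (h : t ≤ c) : stp c δ t = 0 :=
  Real.smoothTransition.zero_of_nonpos (div_nonpos_of_nonpos_of_nonneg (by linarith) hδ.le)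

lemma stp_one {c δ t : ℝ} (hδ : 0 < δ) (h : c + δ ≤ t) : stp c δ t = 1 :=
  Real.smoothTransition.one_of_one_le (by rw [le_div_iff₀ hδ]; linarith)

lemma stp_mono {c δ : ℝ} (hδ : 0 < δ) : Monotone (stp c δ) := fun s t hst =>
  Real.smoothTransition.monotone (by gcongr)

lemma stp_deriv_nonneg {c δ : ℝ} (hδ : 0 < δ) (t : ℝ) : 0 ≤ deriv (stp c δ) t :=
  (stp_mono hδ).deriv_nonneg

lemma stp_deriv_zero {c δ t : ℝ} (hδ : 0 < δ) (h : t ∉ Icc c (c + δ)) :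
    deriv (stp c δ) t = 0 := by
  rw [mem_Icc, not_and_or, not_le, not_le] at h
  rcases h with h | h
  · have : stp c δ =ᶠ[𝓝 t] fun _ => 0 := by
      filter_upwards [Iio_mem_nhds h] with s hs using stp_zero hδ (le_of_lt hs)
    rw [this.deriv_eq]; simp
  · have : stp c δ =ᶠ[𝓝 t] fun _ => 1 := by
      filter_upwards [Ioi_mem_nhds h] with s hs using stp_one hδ (le_of_lt hs)
    rw [this.deriv_eq]; simp

lemma stp_deriv_integral {a b c δ : ℝ} (hδ : 0 < δ) (h1 : a ≤ c) (h2 : c + δ ≤ b) :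
    ∫ t in a..b, deriv (stp c δ) t = 1 := by
  rw [intervalIntegral.integral_deriv_eq_sub
    (fun t _ => (stp_smooth c δ).differentiable (by simp) t)
    (((stp_smooth c δ).continuous_deriv (by simp)).intervalIntegrable _ _),
    stp_one hδ h2, stp_zero hδ h1, sub_zero]

lemma young_time_integral {a b : ℝ} (hab : a < b) {η : Measure (ℝ × E × E)} (h : IsYoung1 a b η)
    {q : ℝ → ℝ} (hq : Continuous q) : ∫ p, q p.1 ∂η = (b - a)⁻¹ * ∫ t in a..b, q t := by
  rw [← lam_integral hab, ← h.2.1, integral_map measurable_fst.aemeasurable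
    hq.aestronglyMeasurable]

lemma delta_ineq {a b : ℝ} {f : ℝ × E × E → ℝ} {C M : ℝ} (hab : a < b)
    (h : LagOK a b f C M) {η : Measure (ℝ × E × E)} (hη : IsTransport a b η)
    {κ δ : ℝ} (hκ : 0 < κ) (hδ : 0 < δ) (hδ' : 4 * δ ≤ b - a) :
    (b - a)⁻¹ * (M - 6 * C * δ) ≤
      ∫ p, (stp (a + δ) δ p.1 - stp (b - 2 * δ) δ p.1) * (f p + κ) ∂η := by
  have hprob : IsProbabilityMeasure η := hη.1.1
  obtain ⟨g, hg, ⟨K, hK⟩, hd, hb⟩ := exists_smooth hab h hκ hδ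
  have hC0 := h.C_nonneg
  have hK0 : 0 ≤ K := (abs_nonneg _).trans (hK 0)
  set ψ₁ := stp (a + δ) δ with hψ₁
  set ψ₂ := stp (b - 2 * δ) δ with hψ₂
  have s1 : ContDiff ℝ (⊤ : ℕ∞) ψ₁ := stp_smooth _ _
  have s2 : ContDiff ℝ (⊤ : ℕ∞) ψ₂ := stp_smooth _ _
  have d1 : Continuous (deriv ψ₁) := s1.continuous_deriv (by simp)
  have d2 : Continuous (deriv ψ₂) := s2.continuous_deriv (by simp)
  have hder : ∀ t, deriv (fun t => ψ₁ t - ψ₂ t) t = deriv ψ₁ t - deriv ψ₂ t := fun t =>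
    deriv_fun_sub (s1.differentiable (by simp) t) (s2.differentiable (by simp) t)
  have hpos : ∀ t, 0 ≤ ψ₁ t - ψ₂ t := by
    intro t
    rw [sub_nonneg]
    exact Real.smoothTransition.monotone (by gcongr; linarith)
  have hle1 : ∀ t, ψ₁ t - ψ₂ t ≤ 1 := by
    intro t
    have e1 : ψ₁ t ≤ 1 := Real.smoothTransition.le_one _
    have e2 : 0 ≤ ψ₂ t := Real.smoothTransition.nonneg _
    linarith
  have hsupp : ∀ t, t ∉ Icc (a + δ) (b - δ) → ψ₁ t - ψ₂ t = 0 := by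
    intro t ht
    rw [mem_Icc, not_and_or, not_le, not_le] at ht
    rcases ht with ht | ht
    · rw [hψ₁, hψ₂, stp_zero hδ ht.le, stp_zero hδ (by linarith), sub_zero]
    · rw [hψ₁, hψ₂, stp_one hδ (by linarith), stp_one hδ (by linarith), sub_self]
  have main := cutoff_ineq h.uc.continuous h.bd hη hδ hg hK hd (s1.sub s2) hpos hle1 hsupp
  simp only [hder] at main
  have bound : ∀ (q : ℝ → ℝ), Continuous q → (∀ t, t ∉ Icc (a + δ) (b - δ) → q t = 0) →
      ∃ D, 0 ≤ D ∧ ∀ t, |q t| ≤ D := by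
    intro q hq hq0
    obtain ⟨D, hD⟩ := (HasCompactSupport.intro isCompact_Icc hq0).exists_bound_of_continuous hq
    exact ⟨D, (norm_nonneg _).trans (hD 0), hD⟩
  obtain ⟨D₁, p1, b1⟩ := bound (deriv ψ₁) d1 (fun t ht => stp_deriv_zero hδ fun h' =>
    ht ⟨h'.1, by linarith [h'.2]⟩)
  obtain ⟨D₂, p2, b2⟩ := bound (deriv ψ₂) d2 (fun t ht => stp_deriv_zero hδ fun h' =>
    ht ⟨by linarith [h'.1], by linarith [h'.2]⟩)
  have i1 : Integrable (fun p : ℝ × E × E =>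
      (deriv ψ₁ p.1 - deriv ψ₂ p.1) * g (p.1, p.2.1)) η := by
    have := hg.continuous
    refine Integrable.of_bound (C := (D₁ + D₂) * K) 
      (Continuous.aestronglyMeasurable (by fun_prop)) (Eventually.of_forall fun p => ?_)
    rw [norm_mul]
    refine mul_le_mul ?_ (hK _) (norm_nonneg _) (by positivity)
    exact (norm_sub_le _ _).trans (add_le_add (b1 _) (b2 _))
  have i2 : Integrable (fun p : ℝ × E × E => (ψ₁ p.1 - ψ₂ p.1) * (f p + κ)) η := by
    have := h.uc.continuous
    have := s1.continuous
    have := s2.continuous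
    refine young_integrable hη.1 (C := C + κ) (by fun_prop) fun p => ?_
    rw [abs_mul, abs_of_nonneg (hpos _)]
    calc _ ≤ 1 * |f p + κ| := by gcongr; exact hle1 _
      _ ≤ C * (1 + ‖p.2.2‖) + |κ| := by
        rw [one_mul]; exact (abs_add_le _ _).trans (by linarith [h.bd p])
      _ ≤ _ := by
        rw [abs_of_pos hκ]
        nlinarith [norm_nonneg p.2.2]
  rw [integral_sub i1 i2] at main
  have i3 : Integrable (fun p : ℝ × E × E =>
      deriv ψ₁ p.1 * (M - 3 * C * δ) - deriv ψ₂ p.1 * (3 * C * δ)) η := by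
    refine Integrable.of_bound (C := D₁ * |M - 3 * C * δ| + D₂ * |3 * C * δ|) 
      (Continuous.aestronglyMeasurable (by fun_prop)) (Eventually.of_forall fun p => ?_)
    refine (norm_sub_le _ _).trans ?_
    rw [norm_mul, norm_mul]
    refine add_le_add ?_ ?_
    · exact mul_le_mul_of_nonneg_right (b1 _) (abs_nonneg _)
    · exact mul_le_mul_of_nonneg_right (b2 _) (abs_nonneg _)
  have hmono := integral_mono i3 i1 (fun p => by
    simp only
    have n1 : 0 ≤ deriv ψ₁ p.1 := stp_deriv_nonneg hδ _
    have n2 : 0 ≤ deriv ψ₂ p.1 := stp_deriv_nonneg hδ _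
    have q1 : deriv ψ₁ p.1 * (M - 3 * C * δ) ≤ deriv ψ₁ p.1 * g (p.1, p.2.1) := by
      by_cases ht : p.1 ∈ Icc (a + δ) (a + δ + δ)
      · refine mul_le_mul_of_nonneg_left ?_ n1
        have := (hb p.1 ⟨ht.1, by linarith [ht.2]⟩ p.2.1).1
        have : C * (p.1 + δ - a) ≤ C * (3 * δ) :=
          mul_le_mul_of_nonneg_left (by linarith [ht.2]) hC0
        linarith
      · rw [hψ₁, stp_deriv_zero hδ ht]; simp
    have q2 : deriv ψ₂ p.1 * g (p.1, p.2.1) ≤ deriv ψ₂ p.1 * (3 * C * δ) := by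
      by_cases ht : p.1 ∈ Icc (b - 2 * δ) (b - 2 * δ + δ)
      · refine mul_le_mul_of_nonneg_left ?_ n2
        have := (hb p.1 ⟨by linarith [ht.1], by linarith [ht.2]⟩ p.2.1).2
        have : C * (b - p.1 + δ) ≤ C * (3 * δ) :=
          mul_le_mul_of_nonneg_left (by linarith [ht.1]) hC0
        linarith
      · rw [hψ₂, stp_deriv_zero hδ ht]; simp
    linarith)
  have hval := young_time_integral hab hη.1
    (q := fun t => deriv ψ₁ t * (M - 3 * C * δ) - deriv ψ₂ t * (3 * C * δ)) (by fun_prop)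
  have hsub : ∫ t in a..b, (deriv ψ₁ t * (M - 3 * C * δ) - deriv ψ₂ t * (3 * C * δ)) =
      (∫ t in a..b, deriv ψ₁ t * (M - 3 * C * δ)) - ∫ t in a..b, deriv ψ₂ t * (3 * C * δ) :=
    intervalIntegral.integral_sub
      (Continuous.intervalIntegrable (by fun_prop) _ _)
      (Continuous.intervalIntegrable (by fun_prop) _ _)
  rw [hsub, intervalIntegral.integral_mul_const,
    intervalIntegral.integral_mul_const, hψ₁, hψ₂,
    stp_deriv_integral hδ (by linarith) (by linarith),
    stp_deriv_integral hδ (by linarith) (by linarith)] at hval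
  have e : (1 : ℝ) * (M - 3 * C * δ) - 1 * (3 * C * δ) = M - 6 * C * δ := by ring
  rw [e] at hval
  rw [← hval]
  linarith

lemma main_ineq {a b : ℝ} {f : ℝ × E × E → ℝ} {C M : ℝ} (hab : a < b)
    (h : LagOK a b f C M) {η : Measure (ℝ × E × E)} (hη : IsTransport a b η) :
    (b - a)⁻¹ * M ≤ ∫ p, f p ∂η := by
  have hprob : IsProbabilityMeasure η := hη.1.1
  have hfint : Integrable f η := young_integrable hη.1 h.uc.continuous h.bd
  refine le_of_forall_pos_le_add fun κ hκ => ?_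
  let δ : ℕ → ℝ := fun n => (b - a) / 4 * (1 / ((n : ℝ) + 1))
  have hba : 0 < b - a := by linarith
  have hδ : ∀ n, 0 < δ n := fun n => by positivity
  have hδ0 : Tendsto δ atTop (𝓝 0) := by
    have := (tendsto_one_div_add_atTop_nhds_zero_nat (𝕜 := ℝ)).const_mul ((b - a) / 4)
    rw [mul_zero] at this
    exact this
  have hδ4 : ∀ n, 4 * δ n ≤ b - a := by
    intro n
    have : 1 / ((n : ℝ) + 1) ≤ 1 := by
      rw [div_le_one (by positivity)]; linarith [(Nat.cast_nonneg n : (0 : ℝ) ≤ n)]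
    simp only [δ]
    nlinarith
  have hineq := fun n => delta_ineq hab h hη hκ (hδ n) (hδ4 n)
  have hl1 : Tendsto (fun n => (b - a)⁻¹ * (M - 6 * C * δ n)) atTop (𝓝 ((b - a)⁻¹ * M)) := by
    simpa using ((hδ0.const_mul (6 * C)).const_sub M).const_mul (b - a)⁻¹
  have hIoo : ∀ᵐ p ∂η, p.1 ∈ Ioo a b := by
    have h1 : ∀ᵐ t ∂(lam a b), t ∈ Ioo a b := by
      unfold lam
      apply Measure.ae_smul_measure
      rw [← restrict_Ioo_eq_restrict_Icc]
      exact ae_restrict_mem measurableSet_Ioo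
    rw [← hη.1.2.1] at h1
    exact ae_of_ae_map measurable_fst.aemeasurable h1
  have hl2 : Tendsto (fun n => ∫ p, (stp (a + δ n) (δ n) p.1 - stp (b - 2 * δ n) (δ n) p.1) *
      (f p + κ) ∂η) atTop (𝓝 (∫ p, (f p + κ) ∂η)) := by
    refine tendsto_integral_of_dominated_convergence (fun p => |f p| + κ) (fun n => ?_)
      (hfint.abs.add (integrable_const _)) (fun n => Eventually.of_forall fun p => ?_) ?_
    · have := h.uc.continuous
      have := (stp_smooth (a + δ n) (δ n)).continuous
      have := (stp_smooth (b - 2 * δ n) (δ n)).continuous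
      exact Continuous.aestronglyMeasurable (by fun_prop)
    · rw [norm_mul]
      have : ‖stp (a + δ n) (δ n) p.1 - stp (b - 2 * δ n) (δ n) p.1‖ ≤ 1 := by
        have e1 : stp (a + δ n) (δ n) p.1 ≤ 1 := Real.smoothTransition.le_one _
        have e2 : 0 ≤ stp (a + δ n) (δ n) p.1 := Real.smoothTransition.nonneg _
        have e3 : stp (b - 2 * δ n) (δ n) p.1 ≤ 1 := Real.smoothTransition.le_one _
        have e4 : 0 ≤ stp (b - 2 * δ n) (δ n) p.1 := Real.smoothTransition.nonneg _
        rw [Real.norm_eq_abs, abs_le]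
        constructor <;> linarith
      calc _ ≤ 1 * ‖f p + κ‖ := by gcongr
        _ ≤ _ := by
          rw [one_mul]
          refine (norm_add_le _ _).trans ?_
          rw [Real.norm_eq_abs, Real.norm_eq_abs, abs_of_pos hκ]
    · filter_upwards [hIoo] with p hp
      refine tendsto_const_nhds.congr' ?_
      have l1 : ∀ᶠ n in atTop, 2 * δ n < p.1 - a := by
        have : Tendsto (fun n => 2 * δ n) atTop (𝓝 0) := by simpa using hδ0.const_mul 2
        exact this.eventually_lt_const (by linarith [hp.1])
      have l2 : ∀ᶠ n in atTop, 2 * δ n < b - p.1 := by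
        have : Tendsto (fun n => 2 * δ n) atTop (𝓝 0) := by simpa using hδ0.const_mul 2
        exact this.eventually_lt_const (by linarith [hp.2])
      filter_upwards [l1, l2] with n h1 h2
      rw [stp_one (hδ n) (by linarith), stp_zero (hδ n) (by linarith)]
      simp
  have := le_of_tendsto_of_tendsto' hl1 hl2 hineq
  rw [integral_add hfint (integrable_const _)] at this
  simpa using this

/-- Cutoff on the phase space. -/
def chiX (m : ℕ) (p : ℝ × E × E) : ℝ := max 0 (min 1 ((m : ℝ) + 1 - ‖p‖))

lemma chiX_cont (m : ℕ) : Continuous (chiX (E := E) m) := by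
  unfold chiX; fun_prop

lemma chiX_nonneg (m : ℕ) (p : ℝ × E × E) : 0 ≤ chiX m p := le_max_left _ _

lemma chiX_le_one (m : ℕ) (p : ℝ × E × E) : chiX m p ≤ 1 :=
  max_le zero_le_one (min_le_left _ _)

lemma chiX_one {m : ℕ} {p : ℝ × E × E} (h : ‖p‖ ≤ m) : chiX m p = 1 := by
  unfold chiX
  rw [min_eq_left (by linarith), max_eq_right zero_le_one]

lemma chiX_zero {m : ℕ} {p : ℝ × E × E} (h : (m : ℝ) + 1 < ‖p‖) : chiX m p = 0 := by
  unfold chiX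
  exact max_eq_left ((min_le_right _ _).trans (by linarith))

lemma chiX_tendsto (p : ℝ × E × E) : Tendsto (fun m => chiX m p) atTop (𝓝 1) := by
  obtain ⟨N, hN⟩ := exists_nat_ge ‖p‖
  refine tendsto_const_nhds.congr' ?_
  filter_upwards [eventually_ge_atTop N] with n hn
  have hn' : (N : ℝ) ≤ n := by exact_mod_cast hn
  exact (chiX_one (hN.trans hn')).symm

/-- Countable family of test functions. -/
def FX : ℕ → (ℝ × E × E → ℝ)
  | 0 => fun p => 1 + ‖p.2.2‖
  | (k + 1) => fun p =>
      (TopologicalSpace.denseSeq C(ℝ × E × E, ℝ) k.unpair.1) p * chiX k.unpair.2 p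

lemma cut_compact (h : ℝ × E × E → ℝ) (m : ℕ) :
    HasCompactSupport (fun p => h p * chiX m p) := by
  refine HasCompactSupport.intro (isCompact_closedBall (0 : ℝ × E × E) ((m : ℝ) + 1)) ?_
  intro p hp
  rw [mem_closedBall_zero_iff, not_le] at hp
  rw [chiX_zero hp, mul_zero]

lemma FX_uc (k : ℕ) : UniformContinuous (FX (E := E) k) := by
  cases k with
  | zero =>
    have : LipschitzWith 1 (fun p : ℝ × E × E => ‖p.2.2‖) := by
      have h := (lipschitzWith_one_norm (E := E)).comp
        ((LipschitzWith.prod_snd (α := E) (β := E)).comp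
          (LipschitzWith.prod_snd (α := ℝ) (β := E × E)))
      simp only [mul_one] at h
      exact h
    exact uniformContinuous_const.add this.uniformContinuous
  | succ k =>
    refine (cut_compact _ _).uniformContinuous_of_continuous ?_
    exact (ContinuousMap.continuous _).mul (chiX_cont _)

lemma cut_bound {h : ℝ × E × E → ℝ} (hh : Continuous h) (m : ℕ) :
    ∃ C : ℝ, 0 ≤ C ∧ ∀ p, |h p * chiX m p| ≤ C * (1 + ‖p.2.2‖) := by
  obtain ⟨C, hC⟩ := (cut_compact h m).exists_bound_of_continuous (hh.mul (chiX_cont m))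
  have hC0 : 0 ≤ C := (norm_nonneg _).trans (hC 0)
  refine ⟨C, hC0, fun p => (hC p).trans ?_⟩
  nlinarith [norm_nonneg p.2.2]

lemma FX_bound (k : ℕ) : ∃ C : ℝ, 0 ≤ C ∧ ∀ p, |FX (E := E) k p| ≤ C * (1 + ‖p.2.2‖) := by
  cases k with
  | zero =>
    refine ⟨1, zero_le_one, fun p => ?_⟩
    rw [one_mul]
    exact (abs_of_nonneg (add_nonneg zero_le_one (norm_nonneg _))).le
  | succ k => exact cut_bound (ContinuousMap.continuous _) _

lemma integrable_lin {ν : Measure (ℝ × E × E)} [IsProbabilityMeasure ν]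
    (hν : Integrable (fun p : ℝ × E × E => ‖p.2.2‖) ν)
    {F : ℝ × E × E → ℝ} (hF : Continuous F) {C : ℝ} (hC : ∀ p, |F p| ≤ C * (1 + ‖p.2.2‖)) :
    Integrable F ν := by
  refine Integrable.mono' (g := fun p => C * (1 + ‖p.2.2‖)) ?_ hF.aestronglyMeasurable
    (Eventually.of_forall hC)
  exact ((integrable_const _).add hν).const_mul _

lemma cut_approx {h : ℝ × E × E → ℝ} (hh : Continuous h) (m : ℕ) {ε : ℝ} (hε : 0 < ε) :
    ∃ k, ∀ p, |h p * chiX m p - FX (E := E) k p| ≤ ε := by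
  let H : C(ℝ × E × E, ℝ) := ⟨h, hh⟩
  have h1 := (ContinuousMap.tendsto_iff_forall_isCompact_tendstoUniformlyOn
    (F := fun f : C(ℝ × E × E, ℝ) => f) (p := 𝓝 H) (f := H)).1 tendsto_id
      _ (isCompact_closedBall (0 : ℝ × E × E) ((m : ℝ) + 1))
  rw [Metric.tendstoUniformlyOn_iff] at h1
  obtain ⟨_, hf, ⟨k, rfl⟩⟩ := mem_closure_iff_nhds.1
    (TopologicalSpace.denseRange_denseSeq C(ℝ × E × E, ℝ) H) _ (h1 ε hε)
  refine ⟨Nat.pair k m + 1, fun p => ?_⟩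
  simp only [FX, Nat.unpair_pair]
  by_cases hp : p ∈ Metric.closedBall (0 : ℝ × E × E) ((m : ℝ) + 1)
  · have := hf p hp
    rw [← sub_mul, abs_mul, abs_of_nonneg (chiX_nonneg m p)]
    rw [Real.dist_eq] at this
    have h2 : |h p - (TopologicalSpace.denseSeq C(ℝ × E × E, ℝ) k) p| ≤ ε := this.le
    calc _ ≤ ε * 1 := mul_le_mul h2 (chiX_le_one m p) (chiX_nonneg m p) hε.le
      _ = ε := mul_one _
  · rw [mem_closedBall_zero_iff, not_le] at hp
    rw [chiX_zero hp]
    simpa using hε.le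

lemma int_close {ν : Measure (ℝ × E × E)} [IsProbabilityMeasure ν] {u v : ℝ × E × E → ℝ}
    (hu : Integrable u ν) (hv : Integrable v ν) {ε : ℝ} (h : ∀ p, |u p - v p| ≤ ε) :
    |∫ p, u p ∂ν - ∫ p, v p ∂ν| ≤ ε := by
  rw [← integral_sub hu hv]
  have := norm_integral_le_of_norm_le_const (μ := ν) (f := fun p => u p - v p)
    (Eventually.of_forall h)
  simpa using this

section conv
variable {μs : ℕ → Measure (ℝ × E × E)} {μ : Measure (ℝ × E × E)}

lemma conv_cut (hp : ∀ n, IsProbabilityMeasure (μs n)) (hp' : IsProbabilityMeasure μ)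
    (hi : ∀ n, Integrable (fun p : ℝ × E × E => ‖p.2.2‖) (μs n))
    (hi' : Integrable (fun p : ℝ × E × E => ‖p.2.2‖) μ)
    (hF : ∀ k, Tendsto (fun n => ∫ p, FX k p ∂(μs n)) atTop (𝓝 (∫ p, FX k p ∂μ)))
    {h : ℝ × E × E → ℝ} (hh : Continuous h) (m : ℕ) :
    Tendsto (fun n => ∫ p, h p * chiX m p ∂(μs n)) atTop (𝓝 (∫ p, h p * chiX m p ∂μ)) := by
  rw [Metric.tendsto_atTop]
  intro ε hε
  obtain ⟨k, hk⟩ := cut_approx hh m (ε := ε / 4) (by positivity)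
  obtain ⟨N, hN⟩ := Metric.tendsto_atTop.1 (hF k) (ε / 4) (by positivity)
  obtain ⟨C1, -, hC1⟩ := cut_bound hh m
  obtain ⟨C2, -, hC2⟩ := FX_bound (E := E) k
  have hc1 : Continuous fun p => h p * chiX m p := hh.mul (chiX_cont m)
  have hc2 := (FX_uc (E := E) k).continuous
  refine ⟨N, fun n hn => ?_⟩
  have a1 := int_close (integrable_lin (hi n) hc1 hC1) (integrable_lin (hi n) hc2 hC2) hk
  have a2 := int_close (integrable_lin hi' hc1 hC1) (integrable_lin hi' hc2 hC2) hk
  have a3 := hN n hn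
  rw [Real.dist_eq] at a3 ⊢
  rw [abs_le] at a1 a2
  rw [abs_lt] at a3 ⊢
  constructor <;> linarith

lemma tail_bound {ν : Measure (ℝ × E × E)} [IsProbabilityMeasure ν]
    (hν : Integrable (fun p : ℝ × E × E => ‖p.2.2‖) ν)
    {f : ℝ × E × E → ℝ} (hf : Continuous f) {C : ℝ} (hC : ∀ p, |f p| ≤ C * (1 + ‖p.2.2‖))
    (m : ℕ) :
    |∫ p, f p ∂ν - ∫ p, f p * chiX m p ∂ν| ≤
      C * (∫ p, (1 + ‖p.2.2‖) ∂ν - ∫ p, (1 + ‖p.2.2‖) * chiX m p ∂ν) := by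
  have hc0 : Continuous fun p : ℝ × E × E => 1 + ‖p.2.2‖ := by fun_prop
  obtain ⟨C1, -, hC1⟩ := cut_bound hf m
  obtain ⟨C2, -, hC2⟩ := cut_bound hc0 m
  have i0 : Integrable (fun p : ℝ × E × E => 1 + ‖p.2.2‖) ν := (integrable_const _).add hν
  have i1 : Integrable (fun p => f p * chiX m p) ν := integrable_lin hν (hf.mul (chiX_cont m)) hC1
  have i2 : Integrable (fun p => (1 + ‖p.2.2‖) * chiX m p) ν := integrable_lin hν (hc0.mul (chiX_cont m)) hC2
  have i3 := integrable_lin hν hf hC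
  rw [← integral_sub i3 i1, ← integral_sub i0 i2, ← integral_const_mul]
  rw [← Real.norm_eq_abs]
  refine norm_integral_le_of_norm_le ((i0.sub i2).const_mul C) (Eventually.of_forall fun p => ?_)
  have e1 : f p - f p * chiX m p = f p * (1 - chiX m p) := by ring
  have e2 : C * ((1 + ‖p.2.2‖) - (1 + ‖p.2.2‖) * chiX m p) =
    C * (1 + ‖p.2.2‖) * (1 - chiX m p) := by ring
  have h1 : 0 ≤ 1 - chiX m p := by linarith [chiX_le_one m p]
  calc ‖f p - f p * chiX m p‖ = |f p| * (1 - chiX m p) := by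
        rw [e1, Real.norm_eq_abs, abs_mul, abs_of_nonneg h1]
    _ ≤ C * (1 + ‖p.2.2‖) * (1 - chiX m p) := mul_le_mul_of_nonneg_right (hC p) h1
    _ = _ := e2.symm

lemma conv_all (hp : ∀ n, IsProbabilityMeasure (μs n)) (hp' : IsProbabilityMeasure μ)
    (hi : ∀ n, Integrable (fun p : ℝ × E × E => ‖p.2.2‖) (μs n))
    (hi' : Integrable (fun p : ℝ × E × E => ‖p.2.2‖) μ)
    (hF : ∀ k, Tendsto (fun n => ∫ p, FX k p ∂(μs n)) atTop (𝓝 (∫ p, FX k p ∂μ))) :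
    Y1Tendsto μs μ := by
  rintro f hf ⟨C, hC⟩
  have hc0 : Continuous fun p : ℝ × E × E => 1 + ‖p.2.2‖ := by fun_prop
  have hT : ∀ m, Tendsto (fun n => C * (∫ p, (1 + ‖p.2.2‖) ∂(μs n) -
      ∫ p, (1 + ‖p.2.2‖) * chiX m p ∂(μs n))) atTop (𝓝 (C * (∫ p, (1 + ‖p.2.2‖) ∂μ -
      ∫ p, (1 + ‖p.2.2‖) * chiX m p ∂μ))) := fun m =>
    ((hF 0).sub (conv_cut hp hp' hi hi' hF hc0 m)).const_mul C
  have hM : Tendsto (fun m => C * (∫ p, (1 + ‖p.2.2‖) ∂μ -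
      ∫ p, (1 + ‖p.2.2‖) * chiX m p ∂μ)) atTop (𝓝 0) := by
    have i0 : Integrable (fun p : ℝ × E × E => 1 + ‖p.2.2‖) μ := (integrable_const _).add hi'
    have : Tendsto (fun m => ∫ p, (1 + ‖p.2.2‖) * chiX m p ∂μ) atTop
        (𝓝 (∫ p, (1 + ‖p.2.2‖) ∂μ)) := by
      refine tendsto_integral_of_dominated_convergence (fun p => 1 + ‖p.2.2‖)
        (fun m => (hc0.mul (chiX_cont m)).aestronglyMeasurable) i0
        (fun m => Eventually.of_forall fun p => ?_) (Eventually.of_forall fun p => ?_)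
      · rw [Real.norm_eq_abs, abs_mul, abs_of_nonneg (chiX_nonneg m p),
          abs_of_nonneg (by positivity)]
        exact mul_le_of_le_one_right (by positivity) (chiX_le_one m p)
      · simpa using (chiX_tendsto p).const_mul (1 + ‖p.2.2‖)
    have h2 := (this.const_sub (∫ p, (1 + ‖p.2.2‖) ∂μ)).const_mul C
    simpa using h2
  rw [Metric.tendsto_atTop]
  intro ε hε
  obtain ⟨m, hm⟩ := (hM.eventually_lt_const (show (0 : ℝ) < ε / 4 by positivity)).exists
  have ev1 := (hT m).eventually_lt_const hm
  obtain ⟨N1, hN1⟩ := eventually_atTop.1 ev1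
  obtain ⟨N2, hN2⟩ := Metric.tendsto_atTop.1 (conv_cut hp hp' hi hi' hF hf m) (ε / 4)
    (by positivity)
  refine ⟨max N1 N2, fun n hn => ?_⟩
  have a1 := tail_bound (hi n) hf hC m
  have a2 := tail_bound hi' hf hC m
  have a3 := hN2 n ((le_max_right _ _).trans hn)
  have a4 := hN1 n ((le_max_left _ _).trans hn)
  rw [Real.dist_eq] at a3 ⊢
  rw [abs_le] at a1 a2
  rw [abs_lt] at a3 ⊢
  constructor <;> linarith

end conv

/-- Finite convex combinations of curve measures. -/
def IsComb (a b : ℝ) (ν : Measure (ℝ × E × E)) : Prop :=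
  ∃ (m : ℕ) (w : Fin m → ℝ) (γs γs' : Fin m → ℝ → E),
    (∀ i, 0 ≤ w i) ∧ (∑ i, w i = 1) ∧ (∀ i, IsACCurve a b (γs i) (γs' i)) ∧
    ν = ∑ i, (ENNReal.ofReal (w i)) • curveMeasure a b (γs i) (γs' i)

lemma comb_integrable {a b : ℝ} (hab : a < b) {m : ℕ} {w : Fin m → ℝ}
    {γs γs' : Fin m → ℝ → E} (hγ : ∀ i, IsACCurve a b (γs i) (γs' i))
    {F : ℝ × E × E → ℝ} (hF : Continuous F) {C : ℝ} (hC : ∀ p, |F p| ≤ C * (1 + ‖p.2.2‖)) :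
    Integrable F (∑ i, (ENNReal.ofReal (w i)) • curveMeasure a b (γs i) (γs' i)) := by
  rw [integrable_finsetSum_measure]
  exact fun i _ => (curve_integrable hab (hγ i) hF hC).smul_measure ENNReal.ofReal_ne_top

lemma comb_integral {a b : ℝ} (hab : a < b) {m : ℕ} {w : Fin m → ℝ} (hw : ∀ i, 0 ≤ w i)
    {γs γs' : Fin m → ℝ → E} (hγ : ∀ i, IsACCurve a b (γs i) (γs' i))
    {F : ℝ × E × E → ℝ} (hF : Continuous F) {C : ℝ} (hC : ∀ p, |F p| ≤ C * (1 + ‖p.2.2‖)) :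
    ∫ p, F p ∂(∑ i, (ENNReal.ofReal (w i)) • curveMeasure a b (γs i) (γs' i)) =
      ∑ i, w i * ∫ p, F p ∂(curveMeasure a b (γs i) (γs' i)) := by
  rw [integral_finsetSum_measure
    (fun i _ => (curve_integrable hab (hγ i) hF hC).smul_measure ENNReal.ofReal_ne_top)]
  refine Finset.sum_congr rfl fun i _ => ?_
  rw [integral_smul_measure, ENNReal.toReal_ofReal (hw i), smul_eq_mul]

lemma comb_prob {a b : ℝ} (hab : a < b) {m : ℕ} {w : Fin m → ℝ} (hw : ∀ i, 0 ≤ w i)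
    (hw1 : ∑ i, w i = 1)
    {γs γs' : Fin m → ℝ → E} (hγ : ∀ i, IsACCurve a b (γs i) (γs' i)) :
    IsProbabilityMeasure (∑ i, (ENNReal.ofReal (w i)) • curveMeasure a b (γs i) (γs' i)) := by
  constructor
  have := fun i => curve_prob hab (hγ i)
  simp only [Measure.coe_finsetSum, Finset.sum_apply, Measure.smul_apply, measure_univ,
    smul_eq_mul, mul_one]
  rw [← ENNReal.ofReal_sum_of_nonneg (fun i _ => hw i), hw1, ENNReal.ofReal_one]

lemma hull_mem {a b : ℝ} (hab : a < b) {η : Measure (ℝ × E × E)} (hη : IsTransport a b η)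
    (n : ℕ) :
    (fun i : Fin (n + 1) => ∫ p, FX i p ∂η) ∈ closure (convexHull ℝ
      {q : Fin (n + 1) → ℝ | ∃ γ γ' : ℝ → E, IsACCurve a b γ γ' ∧
        q = fun i : Fin (n + 1) => ∫ p, FX i p ∂(curveMeasure a b γ γ')}) := by
  by_contra hcon
  obtain ⟨L, u, h1, h2⟩ := geometric_hahn_banach_point_closed
    ((convex_convexHull ℝ _).closure) isClosed_closure hcon
  choose C hC0 hC using FX_bound (E := E)
  let c : Fin (n + 1) → ℝ := fun i => L (Pi.single i 1)
  have hL : ∀ q : Fin (n + 1) → ℝ, L q = ∑ i, c i * q i := by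
    intro q
    conv_lhs => rw [pi_eq_sum_univ' q]
    rw [map_sum]
    refine Finset.sum_congr rfl fun i _ => ?_
    rw [map_smul, smul_eq_mul, mul_comm]
  let f : ℝ × E × E → ℝ := fun p => ∑ i : Fin (n + 1), c i * FX i p
  have hItg : ∀ ν : Measure (ℝ × E × E), (∀ k, Integrable (FX k) ν) →
      ∫ p, f p ∂ν = L (fun i => ∫ p, FX i p ∂ν) := by
    intro ν hν
    rw [hL]
    simp only [f]
    rw [integral_finsetSum Finset.univ (f := fun (i : Fin (n + 1)) p => c i * FX (E := E) i p)
      (fun i _ => (hν i).const_mul _)]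
    exact Finset.sum_congr rfl fun i _ => integral_const_mul _ _
  have hba : 0 < b - a := by linarith
  have hfu : UniformContinuous f := by
    have : ∀ s : Finset (Fin (n + 1)), UniformContinuous fun p => ∑ i ∈ s, c i * FX (E := E) i p := by
      intro s
      induction s using Finset.induction_on with
      | empty => simpa using uniformContinuous_const
      | insert i s hi ih =>
        simp only [Finset.sum_insert hi]
        exact ((FX_uc (E := E) i).const_mul' (c i)).add ih
    exact this _
  have hOK : LagOK a b f (∑ i : Fin (n + 1), |c i| * C i) (u * (b - a)) := by
    refine ⟨hfu, fun p => ?_, fun γ γ' hγ => ?_⟩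
    · refine (Finset.abs_sum_le_sum_abs _ _).trans ?_
      rw [Finset.sum_mul]
      refine Finset.sum_le_sum fun i _ => ?_
      rw [abs_mul, mul_assoc]
      exact mul_le_mul_of_nonneg_left (hC i p) (abs_nonneg _)
    · have e1 := curve_integral hab hγ hfu.continuous
      rw [hItg _ fun k => curve_integrable hab hγ (FX_uc k).continuous (hC k)] at e1
      have e2 := h2 _ (subset_closure (subset_convexHull ℝ _ ⟨γ, γ', hγ, rfl⟩))
      rw [e1, inv_mul_eq_div, lt_div_iff₀ hba] at e2
      exact e2.le
  have := main_ineq hab hOK hη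
  rw [hItg _ fun k => young_integrable hη.1 (FX_uc k).continuous (hC k)] at this
  have e : (b - a)⁻¹ * (u * (b - a)) = u := by field_simp
  rw [e] at this
  linarith

lemma exists_comb {a b : ℝ} (hab : a < b) {η : Measure (ℝ × E × E)} (hη : IsTransport a b η)
    (n : ℕ) : ∃ ν : Measure (ℝ × E × E), IsComb a b ν ∧ ∀ k ≤ n,
      |∫ p, FX k p ∂ν - ∫ p, FX k p ∂η| ≤ 1 / ((n : ℝ) + 1) := by
  obtain ⟨q, hq, hd⟩ := Metric.mem_closure_iff.1 (hull_mem hab hη n) (1 / ((n : ℝ) + 1))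
    (by positivity)
  rw [mem_convexHull_iff_exists_fintype] at hq
  obtain ⟨ι, _, w, z, hw0, hw1, hz, hs⟩ := hq
  choose γ γ' hγ hzγ using hz
  let e := Fintype.equivFin ι
  have hγ2 : ∀ i, IsACCurve a b (γ (e.symm i)) (γ' (e.symm i)) := fun i => hγ _
  refine ⟨_, ⟨Fintype.card ι, fun i => w (e.symm i), fun i => γ (e.symm i),
    fun i => γ' (e.symm i), fun i => hw0 _, ?_, hγ2, rfl⟩, fun k hk => ?_⟩
  · rw [← hw1]; exact Equiv.sum_comp e.symm w
  · obtain ⟨C, -, hC⟩ := FX_bound (E := E) k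
    rw [comb_integral hab (fun i => hw0 _) hγ2 (FX_uc k).continuous hC]
    let k' : Fin (n + 1) := ⟨k, Nat.lt_succ_of_le hk⟩
    have hqk : q k' = ∑ i, w (e.symm i) *
        ∫ p, FX k p ∂(curveMeasure a b (γ (e.symm i)) (γ' (e.symm i))) := by
      rw [← hs, Finset.sum_apply]
      rw [← Equiv.sum_comp e.symm]
      refine Finset.sum_congr rfl fun i _ => ?_
      rw [hzγ]
      rfl
    rw [← hqk]
    have h1 := (dist_le_pi_dist (fun i : Fin (n + 1) => ∫ p, FX i p ∂η) q k').trans hd.le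
    rw [dist_comm, Real.dist_eq] at h1
    exact h1

lemma young_super {a b : ℝ} (hab : a < b) {η : Measure (ℝ × E × E)} (hY : IsYoung1 a b η) :
    IsTransport a b η ↔ ∃ ηs : ℕ → Measure (ℝ × E × E),
      (∀ n, IsComb a b (ηs n)) ∧ Y1Tendsto ηs η := by
  constructor
  · intro hη
    choose ηs hc hd using exists_comb hab hη
    have hn : Continuous fun p : ℝ × E × E => ‖p.2.2‖ := by fun_prop
    refine ⟨ηs, hc, conv_all (fun n => ?_) hY.1 (fun n => ?_) hY.2.2 fun k => ?_⟩
    · obtain ⟨m, w, γs, γs', h0, h1, h2, h3⟩ := hc n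
      rw [h3]
      exact comb_prob hab h0 h1 h2
    · obtain ⟨m, w, γs, γs', h0, h1, h2, h3⟩ := hc n
      rw [h3]
      refine comb_integrable hab h2 hn (C := 1) fun p => ?_
      rw [abs_of_nonneg (norm_nonneg _)]
      linarith
    · rw [tendsto_iff_dist_tendsto_zero]
      refine squeeze_zero' (Eventually.of_forall fun _ => dist_nonneg) ?_
        (tendsto_one_div_add_atTop_nhds_zero_nat (𝕜 := ℝ))
      filter_upwards [eventually_ge_atTop k] with n hn
      exact hd n k hn
  · rintro ⟨ηs, hc, ht⟩
    refine ⟨hY, fun g hg => ?_⟩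
    have hcont := tIntegrand_cont hg.1
    have hb := tIntegrand_bound hg.1 hg.2.1
    have h1 := ht _ hcont hb
    have h2 : ∀ n, ∫ p, tIntegrand g p ∂(ηs n) = 0 := by
      intro n
      obtain ⟨C, hC⟩ := hb
      obtain ⟨m, w, γs, γs', h0, h1, h2, h3⟩ := hc n
      rw [h3, comb_integral hab h0 h2 hcont hC]
      refine Finset.sum_eq_zero fun i _ => ?_
      rw [curve_transport hab (h2 i) hg, mul_zero]
    simp only [h2] at h1
    exact tendsto_nhds_unique h1 tendsto_const_nhds

/-- Young's superposition principle: the set `𝒯(I,ℝᵈ)` of transport measures is the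
closed convex envelope in `𝒴₁(I,ℝ²ᵈ)` of the set `𝒞(I,ℝᵈ)` of measures `γ̄` of
absolutely continuous curves: a Young measure is a transport measure iff it is a
(sequential) limit of finite convex combinations of measures `γ̄`. -/
theorem young_superposition_principle
    (d : ℕ) (hd : 1 ≤ d) (a b : ℝ) (hab : a < b)
    (η : Measure (ℝ × EuclideanSpace ℝ (Fin d) × EuclideanSpace ℝ (Fin d)))
    (hY : IsYoung1 a b η) :
    IsTransport a b η ↔
      ∃ ηs : ℕ → Measure (ℝ × EuclideanSpace ℝ (Fin d) × EuclideanSpace ℝ (Fin d)),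
        (∀ n, ∃ (m : ℕ) (w : Fin m → ℝ)
            (γs γs' : Fin m → ℝ → EuclideanSpace ℝ (Fin d)),
          (∀ i, 0 ≤ w i) ∧ (∑ i, w i = 1) ∧
          (∀ i, IsACCurve a b (γs i) (γs' i)) ∧
          ηs n = ∑ i, (ENNReal.ofReal (w i)) • curveMeasure a b (γs i) (γs' i)) ∧
        Y1Tendsto ηs η := by
  exact young_super hab hY
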